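/- arXiv:2210.07854 — 2 statements merged into one kernel-verified Lean document; each statement's English description precedes it below -/
import Mathlib

section
/- Let k ∈ ℂ with Re(k) < 0, and let f : ℚ → ℂ be 1-periodic (f(x+1) = f(x) for all x ∈ ℚ) and satisfy f(x) − |x|^{−k}·f(−1/x) = h(x) for all x ∈ ℚ\{0}, where h : ℝ\{0} → ℂ is continuous on [−1,1]\{0} and has finite one-sided limits h(0⁺) = lim_{t→0⁺} h(t) and h(0⁻) = lim_{t→0⁻} h(t). Then: (a) for every irrational x ∈ ℝ the limit lim_{ℚ∋y→x} f(y) exists; denote by f† : ℝ → ℂ the function equal to f on ℚ and to this limit at irrationals; (b) f† is continuous at every irrational point; (c) for every reduced rational x = a/q, lim_{y→x, y>x} f†(y) = f(x) + q^k·(h(0⁺) − f(0)) and lim_{y→x, y<x} f†(y) = f(x) + q^k·(h(0⁻) − f(0)). In particular, f† is continuous on ℝ if and only if h(0⁺) = h(0⁻) = f(0). -/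
open Filter Topology MeasureTheory Set

/-- Induction on rationals along the nearest-integer continued fraction algorithm. -/
theorem rat_induction_add_int_neg_inv {P : ℚ → Prop} (zero : P 0)
    (add_int : ∀ (x : ℚ) (n : ℤ), P x → P (x + n))
    (neg_inv : ∀ x : ℚ, x ≠ 0 → |x| ≤ 1 / 2 → P (-1 / x) → P x) (x : ℚ) : P x := by
  induction hd : x.den using Nat.strong_induction_on generalizing x with
  | _ d ih =>
    have hround : |x - round x| ≤ 1 / 2 := abs_sub_round x
    set z : ℚ := x - round x with hz
    suffices P z by
      have hx := add_int z (round x) this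
      rwa [hz, sub_add_cancel] at hx
    have hzd : z.den = d := by rw [hz, Rat.sub_intCast_den, hd]
    by_cases hz0 : z = 0
    · rwa [hz0]
    refine neg_inv z hz0 hround (ih (-1 / z).den ?_ _ rfl)
    have hden : (-1 / z).den = z.num.natAbs := by
      rw [neg_div, one_div, Rat.neg_den, Rat.den_inv_of_ne_zero hz0]
    have hdpos : (0 : ℚ) < z.den := by exact_mod_cast z.den_pos
    have habs : |(z.num : ℚ)| < z.den := by
      rw [← Rat.num_div_den z, abs_div, abs_of_pos hdpos, div_le_iff₀ hdpos] at hround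
      linarith
    rw [hden, ← hzd]
    have : ((z.num.natAbs : ℕ) : ℚ) < z.den := by rwa [Nat.cast_natAbs, Int.cast_abs]
    exact_mod_cast this

theorem exists_norm_le_of_tendsto_zero {h : ℝ → ℂ}
    (hcont : ContinuousOn h (Icc (-1 : ℝ) 1 \ {0})) {a b : ℂ}
    (hp : Tendsto h (𝓝[>] 0) (𝓝 a)) (hm : Tendsto h (𝓝[<] 0) (𝓝 b)) :
    ∃ M : ℝ, ∀ x : ℝ, |x| ≤ 1 → x ≠ 0 → ‖h x‖ ≤ M := by
  suffices ∃ M : ℝ, ∀ x ∈ Icc (-1 : ℝ) 1, x ≠ 0 → ‖h x‖ ≤ M by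
    obtain ⟨M, hM⟩ := this
    exact ⟨M, fun x hx => hM x (abs_le.mp hx)⟩
  refine isCompact_Icc.induction_on (p := fun s => ∃ M : ℝ, ∀ x ∈ s, x ≠ 0 → ‖h x‖ ≤ M)
    ⟨0, by simp⟩ (fun s t hst ⟨M, hM⟩ => ⟨M, fun x hx => hM x (hst hx)⟩) ?_ ?_
  · rintro s t ⟨M, hM⟩ ⟨N, hN⟩
    refine ⟨max M N, ?_⟩
    rintro x (hx | hx) hx0
    · exact (hM x hx hx0).trans (le_max_left _ _)
    · exact (hN x hx hx0).trans (le_max_right _ _)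
  · intro x hx
    by_cases hx0 : x = 0
    · subst hx0
      have h1 : ∀ᶠ y in 𝓝[>] (0 : ℝ), ‖h y‖ ≤ max (‖a‖ + 1) (‖b‖ + 1) :=
        (hp.norm.eventually_le_const (lt_add_one _)).mono fun y hy => hy.trans (le_max_left _ _)
      have h2 : ∀ᶠ y in 𝓝[<] (0 : ℝ), ‖h y‖ ≤ max (‖a‖ + 1) (‖b‖ + 1) :=
        (hm.norm.eventually_le_const (lt_add_one _)).mono fun y hy => hy.trans (le_max_right _ _)
      have h3 : ∀ᶠ y in 𝓝[≠] (0 : ℝ), ‖h y‖ ≤ max (‖a‖ + 1) (‖b‖ + 1) := by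
        rw [← nhdsLT_sup_nhdsGT]
        exact eventually_sup.mpr ⟨h2, h1⟩
      exact ⟨_, mem_nhdsWithin_of_mem_nhds (eventually_nhdsWithin_iff.mp h3), _, fun y hy => hy⟩
    · have h1 := (hcont x ⟨hx, hx0⟩).norm.eventually_le_const (lt_add_one ‖h x‖)
      rw [sdiff_eq, nhdsWithin_inter_of_mem'
        (mem_nhdsWithin_of_mem_nhds (isOpen_compl_singleton.mem_nhds hx0))] at h1
      exact ⟨_, h1, _, fun y hy _ => hy⟩

theorem continuousAt_of_abs_le_half {h : ℝ → ℂ}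
    (hcont : ContinuousOn h (Icc (-1 : ℝ) 1 \ {0})) {x : ℝ} (hx0 : x ≠ 0) (hx : |x| ≤ 1 / 2) :
    ContinuousAt h x := by
  obtain ⟨h1, h2⟩ := abs_le.mp hx
  exact hcont.continuousAt (inter_mem (Icc_mem_nhds (by linarith) (by linarith))
    (isOpen_ne.mem_nhds hx0))

theorem continuousAt_abs_cpow (k : ℂ) {x : ℝ} (hx : x ≠ 0) :
    ContinuousAt (fun t : ℝ => ((|t| : ℝ) : ℂ) ^ k) x := by
  refine ContinuousAt.cpow (by fun_prop) continuousAt_const ?_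
  exact Complex.ofReal_mem_slitPlane.mpr (abs_pos.mpr hx)

theorem norm_abs_cpow (k : ℂ) {x : ℝ} (hx : x ≠ 0) :
    ‖((|x| : ℝ) : ℂ) ^ k‖ = |x| ^ k.re :=
  Complex.norm_cpow_eq_rpow_re_of_pos (abs_pos.mpr hx) k

theorem norm_abs_cpow_le {k : ℂ} (hk : k.re < 0) {x : ℝ} (hx0 : x ≠ 0) (hx : |x| ≤ 1 / 2) :
    ‖((|x| : ℝ) : ℂ) ^ (-k)‖ ≤ (1 / 2 : ℝ) ^ (-k).re := by
  rw [norm_abs_cpow _ hx0]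
  exact Real.rpow_le_rpow (abs_nonneg x) hx (by simpa using hk.le)

theorem half_rpow_lt_one {k : ℂ} (hk : k.re < 0) : (1 / 2 : ℝ) ^ (-k).re < 1 :=
  Real.rpow_lt_one (by norm_num) (by norm_num) (by simpa using hk)

theorem abs_ratCast_le_half {x : ℚ} (hx : |x| ≤ 1 / 2) : |(x : ℝ)| ≤ 1 / 2 := by
  have := (Rat.cast_le (K := ℝ)).mpr hx
  push_cast at this
  exact this

theorem apply_add_int {f : ℚ → ℂ} (hper : ∀ x : ℚ, f (x + 1) = f x) (x : ℚ) (n : ℤ) :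
    f (x + n) = f x := by
  simpa using (show Function.Periodic f 1 from hper).int_mul n x

theorem eq_add_cpow_mul {k : ℂ} {f : ℚ → ℂ} {h : ℝ → ℂ}
    (hrec : ∀ x : ℚ, x ≠ 0 →
      f x - ((|((x : ℚ) : ℝ)| : ℝ) : ℂ) ^ (-k) * f (-1 / x) = h x) {x : ℚ} (hx : x ≠ 0) :
    f x = h x + ((|((x : ℚ) : ℝ)| : ℝ) : ℂ) ^ (-k) * f (-1 / x) :=
  sub_eq_iff_eq_add.mp (hrec x hx)

theorem exists_norm_le_of_period_function {k : ℂ} (hk : k.re < 0) {f : ℚ → ℂ} {h : ℝ → ℂ}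
    (hper : ∀ x : ℚ, f (x + 1) = f x)
    (hrec : ∀ x : ℚ, x ≠ 0 →
      f x - ((|((x : ℚ) : ℝ)| : ℝ) : ℂ) ^ (-k) * f (-1 / x) = h x)
    {M : ℝ} (hM : ∀ x : ℝ, |x| ≤ 1 → x ≠ 0 → ‖h x‖ ≤ M) :
    ∃ C : ℝ, ∀ x : ℚ, ‖f x‖ ≤ C := by
  set r : ℝ := (1 / 2 : ℝ) ^ (-k).re with hr
  have hr1 : r < 1 := half_rpow_lt_one hk
  refine ⟨max ‖f 0‖ (M / (1 - r)), rat_induction_add_int_neg_inv (le_max_left _ _)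
    (fun x n hx => by rwa [apply_add_int hper]) fun x hx0 hx ih => ?_⟩
  set C := max ‖f 0‖ (M / (1 - r))
  have hxR0 : (x : ℝ) ≠ 0 := by exact_mod_cast hx0
  have hxR : |(x : ℝ)| ≤ 1 / 2 := abs_ratCast_le_half hx
  have hMC : M ≤ C * (1 - r) := (div_le_iff₀ (by linarith)).mp (le_max_right _ _)
  calc ‖f x‖ ≤ ‖h x‖ + ‖((|(x : ℝ)| : ℝ) : ℂ) ^ (-k)‖ * ‖f (-1 / x)‖ := by
        rw [eq_add_cpow_mul hrec hx0, ← norm_mul]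
        exact norm_add_le _ _
    _ ≤ M + r * C := by
        gcongr
        · exact hM x (by linarith) hxR0
        · exact norm_abs_cpow_le hk hxR0 hxR
    _ ≤ C := by linarith

theorem tendsto_comap_ratCast {F G : Filter ℝ} {u : ℚ → ℚ} {v : ℝ → ℝ}
    (huv : ∀ y, ((u y : ℚ) : ℝ) = v y) (hv : Tendsto v F G) :
    Tendsto u (comap ((↑) : ℚ → ℝ) F) (comap ((↑) : ℚ → ℝ) G) := by
  rw [tendsto_comap_iff]
  exact (hv.comp tendsto_comap).congr fun y => (huv y).symm

theorem neg_one_div_ratCast (y : ℚ) : ((-1 / y : ℚ) : ℝ) = -1 / (y : ℝ) := by push_cast; rfl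

theorem add_int_ratCast (n : ℤ) (y : ℚ) : ((y + n : ℚ) : ℝ) = (y : ℝ) + n := by push_cast; rfl

theorem eventually_comap_ratCast_ne_zero {F : Filter ℝ} (hF : ∀ᶠ t in F, t ≠ 0) :
    ∀ᶠ y : ℚ in comap ((↑) : ℚ → ℝ) F, y ≠ 0 :=
  (tendsto_comap.eventually hF).mono fun y hy => by exact_mod_cast hy

/-- Limits of `f` at rational points along a family of neighbourhood filters `𝓝[S x] x` that is
compatible with `x ↦ x + n` and `x ↦ -1 / x`. -/
theorem tendsto_comap_ratCast_nhdsWithin {k : ℂ} (hk : k.re < 0) {f : ℚ → ℂ} {h : ℝ → ℂ}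
    (hper : ∀ x : ℚ, f (x + 1) = f x)
    (hrec : ∀ x : ℚ, x ≠ 0 →
      f x - ((|((x : ℚ) : ℝ)| : ℝ) : ℂ) ^ (-k) * f (-1 / x) = h x)
    (hcont : ContinuousOn h (Icc (-1 : ℝ) 1 \ {0})) {C : ℝ} (hC : ∀ x : ℚ, ‖f x‖ ≤ C)
    {S : ℝ → Set ℝ} (hS0 : (0 : ℝ) ∉ S 0)
    (hSadd : ∀ (x : ℝ) (n : ℤ), Tendsto (fun t : ℝ => t + n) (𝓝[S x] x) (𝓝[S (x + n)] (x + n)))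
    (hSinv : ∀ x : ℝ, x ≠ 0 → Tendsto (fun t => -1 / t) (𝓝[S x] x) (𝓝[S (-1 / x)] (-1 / x)))
    {L : ℂ} (hL : Tendsto h (𝓝[S 0] 0) (𝓝 L)) (x : ℚ) :
    Tendsto f (comap ((↑) : ℚ → ℝ) (𝓝[S x] (x : ℝ)))
      (𝓝 (f x + ((x.den : ℝ) : ℂ) ^ k * (L - f 0))) := by
  induction x using rat_induction_add_int_neg_inv with
  | zero =>
    have hne : ∀ᶠ y : ℚ in comap ((↑) : ℚ → ℝ) (𝓝[S 0] 0), y ≠ 0 :=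
      eventually_comap_ratCast_ne_zero
        (eventually_mem_nhdsWithin.mono fun t ht h0 => hS0 (h0 ▸ ht))
    have hw : Tendsto (fun t : ℝ => |t| ^ (-k).re) (𝓝[S 0] 0) (𝓝 0) := by
      have hk' : 0 < (-k).re := by simpa using hk
      have hc : ContinuousAt (fun t : ℝ => |t| ^ (-k).re) 0 :=
        continuous_abs.continuousAt.rpow_const (Or.inr hk'.le)
      have := hc.tendsto
      rw [abs_zero, Real.zero_rpow hk'.ne'] at this
      exact this.mono_left nhdsWithin_le_nhds
    have hz : Tendsto (fun y : ℚ => ((|(y : ℝ)| : ℝ) : ℂ) ^ (-k) * f (-1 / y))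
        (comap ((↑) : ℚ → ℝ) (𝓝[S 0] 0)) (𝓝 0) := by
      have hb := (hw.comp (tendsto_comap (f := ((↑) : ℚ → ℝ)))).mul_const C
      rw [zero_mul] at hb
      refine squeeze_zero_norm' ?_ hb
      filter_upwards [hne] with y hy
      rw [norm_mul, norm_abs_cpow _ (by exact_mod_cast hy)]
      exact mul_le_mul_of_nonneg_left (hC _) (by positivity)
    have := (hL.comp (tendsto_comap (f := ((↑) : ℚ → ℝ)))).add hz
    simp only [Rat.cast_zero, Rat.den_ofNat, Nat.cast_one, Complex.ofReal_one, Complex.one_cpow,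
      one_mul, add_sub_cancel]
    rw [add_zero] at this
    refine this.congr' ?_
    filter_upwards [hne] with y hy
    exact (eq_add_cpow_mul hrec hy).symm
  | add_int x n ih =>
    rw [apply_add_int hper, Rat.add_intCast_den]
    have hs := hSadd ((x + n : ℚ) : ℝ) (-n)
    have hx : ((x + n : ℚ) : ℝ) + ((-n : ℤ) : ℝ) = x := by push_cast; ring
    rw [hx] at hs
    have := ih.comp (tendsto_comap_ratCast (add_int_ratCast (-n)) hs)
    exact this.congr fun y => apply_add_int hper y (-n)
  | neg_inv x hx0 hx ih =>
    have hxR0 : (x : ℝ) ≠ 0 := by exact_mod_cast hx0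
    have hxR : |(x : ℝ)| ≤ 1 / 2 := abs_ratCast_le_half hx
    have hs := hSinv x hxR0
    rw [← neg_one_div_ratCast] at hs
    have h1 := ih.comp (tendsto_comap_ratCast neg_one_div_ratCast hs)
    have hle : (𝓝[S x] (x : ℝ)) ≤ 𝓝 (x : ℝ) := nhdsWithin_le_nhds
    have h2 := ((continuousAt_abs_cpow (-k) hxR0).tendsto.mono_left hle).comp
      (tendsto_comap (f := ((↑) : ℚ → ℝ)))
    have h3 := ((continuousAt_of_abs_le_half hcont hxR0 hxR).tendsto.mono_left hle).comp
      (tendsto_comap (f := ((↑) : ℚ → ℝ)))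
    have h4 := h3.add (h2.mul h1)
    have hval : h x + ((|(x : ℝ)| : ℝ) : ℂ) ^ (-k) *
        (f (-1 / x) + (((-1 / x).den : ℝ) : ℂ) ^ k * (L - f 0)) =
        f x + ((x.den : ℝ) : ℂ) ^ k * (L - f 0) := by
      rw [eq_add_cpow_mul hrec hx0, mul_add, ← add_assoc, ← mul_assoc]
      congr 2
      have hden : (((-1 / x).den : ℕ) : ℝ) = |(x : ℝ)| * x.den := by
        have hnum : (x.num : ℝ) = x * x.den := by exact_mod_cast (Rat.mul_den_eq_num x).symm
        rw [neg_div, one_div, Rat.neg_den, Rat.den_inv_of_ne_zero hx0, Nat.cast_natAbs,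
          Int.cast_abs, hnum, abs_mul, Nat.abs_cast]
      have hx' : ((|(x : ℝ)| : ℝ) : ℂ) ≠ 0 := by exact_mod_cast abs_ne_zero.mpr hxR0
      rw [hden, Complex.ofReal_mul, Complex.mul_cpow_ofReal_nonneg (abs_nonneg _)
        (Nat.cast_nonneg _), ← mul_assoc, ← Complex.cpow_add _ _ hx', neg_add_cancel,
        Complex.cpow_zero, one_mul]
    rw [← hval]
    refine h4.congr' ?_
    filter_upwards [eventually_comap_ratCast_ne_zero (hle (isOpen_ne.mem_nhds hxR0))] with y hy
    exact (eq_add_cpow_mul hrec hy).symm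

theorem tendsto_neg_one_div_nhds {x : ℝ} (hx : x ≠ 0) :
    Tendsto (fun t : ℝ => -1 / t) (𝓝 x) (𝓝 (-1 / x)) :=
  (continuousAt_const.div continuousAt_id hx).tendsto

/-- A bound for the oscillation of `f` at all irrational points improves by a constant factor. -/
theorem eventually_dist_le_of_eventually_dist_le {k : ℂ} (hk : k.re < 0) {f : ℚ → ℂ} {h : ℝ → ℂ}
    (hper : ∀ x : ℚ, f (x + 1) = f x)
    (hrec : ∀ x : ℚ, x ≠ 0 →
      f x - ((|((x : ℚ) : ℝ)| : ℝ) : ℂ) ^ (-k) * f (-1 / x) = h x)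
    (hcont : ContinuousOn h (Icc (-1 : ℝ) 1 \ {0})) {C : ℝ} (hC : ∀ x : ℚ, ‖f x‖ ≤ C)
    {r c : ℝ} (hr : (1 / 2 : ℝ) ^ (-k).re < r) (hc : 0 < c)
    (hosc : ∀ x : ℝ, Irrational x →
      ∀ᶠ p in comap ((↑) : ℚ → ℝ) (𝓝 x) ×ˢ comap ((↑) : ℚ → ℝ) (𝓝 x), dist (f p.1) (f p.2) ≤ c)
    {x : ℝ} (hx : Irrational x) :
    ∀ᶠ p in comap ((↑) : ℚ → ℝ) (𝓝 x) ×ˢ comap ((↑) : ℚ → ℝ) (𝓝 x),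
      dist (f p.1) (f p.2) ≤ r * c := by
  wlog hx2 : |x| ≤ 1 / 2 generalizing x
  · have hs : Tendsto (fun t : ℝ => t + ((-round x : ℤ) : ℝ)) (𝓝 x) (𝓝 (x - round x)) := by
      have : Continuous fun t : ℝ => t + ((-round x : ℤ) : ℝ) := by fun_prop
      simpa [sub_eq_add_neg] using this.tendsto x
    have ht := tendsto_comap_ratCast (add_int_ratCast (-round x)) hs
    refine ((ht.prodMap ht).eventually
      (this (hx.sub_intCast (round x)) (abs_sub_round x))).mono fun p hp => ?_
    simpa only [Prod.map, apply_add_int hper] using hp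
  have hx0 : x ≠ 0 := hx.ne_zero
  set F := comap ((↑) : ℚ → ℝ) (𝓝 x)
  have hcast : Tendsto ((↑) : ℚ → ℝ) F (𝓝 x) := tendsto_comap
  set w : ℝ → ℂ := fun t => ((|t| : ℝ) : ℂ) ^ (-k) with hw
  have hwt : Tendsto (fun y : ℚ => w y) F (𝓝 (w x)) :=
    (continuousAt_abs_cpow (-k) hx0).tendsto.comp hcast
  have hht : Tendsto (fun y : ℚ => h y) F (𝓝 (h x)) :=
    (continuousAt_of_abs_le_half hcont hx0 hx2).tendsto.comp hcast
  have hlim : Tendsto (fun p : ℚ × ℚ => dist (h p.1) (h p.2) + ‖w p.1‖ * c +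
      dist (w p.1) (w p.2) * C) (F ×ˢ F) (𝓝 (‖w x‖ * c)) := by
    have h1 := (hht.comp (tendsto_fst (g := F))).dist (hht.comp (tendsto_snd (f := F)))
    have h2 := (hwt.comp (tendsto_fst (g := F))).norm.mul_const c
    have h3 := ((hwt.comp (tendsto_fst (g := F))).dist
      (hwt.comp (tendsto_snd (f := F)))).mul_const C
    simpa using (h1.add h2).add h3
  have hlt : ‖w x‖ * c < r * c := by
    gcongr
    exact (norm_abs_cpow_le hk hx0 hx2).trans_lt hr
  have hinv : Tendsto (fun y : ℚ => -1 / y) F (comap ((↑) : ℚ → ℝ) (𝓝 (-1 / x))) :=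
    tendsto_comap_ratCast neg_one_div_ratCast (tendsto_neg_one_div_nhds hx0)
  have hxinv : Irrational (-1 / x) := by
    simpa [neg_div] using hx.inv.neg
  have hne : ∀ᶠ y : ℚ in F, y ≠ 0 := eventually_comap_ratCast_ne_zero (isOpen_ne.mem_nhds hx0)
  filter_upwards [hlim.eventually_le_const hlt, (hinv.prodMap hinv).eventually (hosc _ hxinv),
    tendsto_fst.eventually hne, tendsto_snd.eventually hne] with p hp hpo hp1 hp2
  refine le_trans ?_ hp
  rw [eq_add_cpow_mul hrec hp1, eq_add_cpow_mul hrec hp2, dist_eq_norm]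
  have key : h p.1 + w p.1 * f (-1 / p.1) - (h p.2 + w p.2 * f (-1 / p.2)) =
      (h p.1 - h p.2) + w p.1 * (f (-1 / p.1) - f (-1 / p.2)) +
        (w p.1 - w p.2) * f (-1 / p.2) := by ring
  have hpo' : ‖f (-1 / p.1) - f (-1 / p.2)‖ ≤ c := by rw [← dist_eq_norm]; exact hpo
  calc _ = ‖(h p.1 - h p.2) + w p.1 * (f (-1 / p.1) - f (-1 / p.2)) +
        (w p.1 - w p.2) * f (-1 / p.2)‖ := by rw [← key]
    _ ≤ ‖h p.1 - h p.2‖ + ‖w p.1‖ * ‖f (-1 / p.1) - f (-1 / p.2)‖ +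
        ‖w p.1 - w p.2‖ * ‖f (-1 / p.2)‖ := by
      rw [← norm_mul, ← norm_mul]
      exact norm_add₃_le
    _ ≤ _ := by
      rw [dist_eq_norm, dist_eq_norm]
      gcongr
      exact hC _

theorem exists_tendsto_comap_ratCast_of_irrational {k : ℂ} (hk : k.re < 0) {f : ℚ → ℂ}
    {h : ℝ → ℂ} (hper : ∀ x : ℚ, f (x + 1) = f x)
    (hrec : ∀ x : ℚ, x ≠ 0 →
      f x - ((|((x : ℚ) : ℝ)| : ℝ) : ℂ) ^ (-k) * f (-1 / x) = h x)
    (hcont : ContinuousOn h (Icc (-1 : ℝ) 1 \ {0})) {C : ℝ} (hC : ∀ x : ℚ, ‖f x‖ ≤ C)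
    {x : ℝ} (hx : Irrational x) :
    ∃ l, Tendsto f (comap ((↑) : ℚ → ℝ) (𝓝 x)) (𝓝 l) := by
  obtain ⟨r, hr, hr1⟩ := exists_between (half_rpow_lt_one hk)
  have hr0 : 0 < r := lt_trans (by positivity) hr
  set c : ℝ := 2 * C + 1 with hcdef
  have hc : 0 < c := by linarith [(norm_nonneg _).trans (hC 0)]
  have hosc : ∀ n : ℕ, ∀ x : ℝ, Irrational x →
      ∀ᶠ p in comap ((↑) : ℚ → ℝ) (𝓝 x) ×ˢ comap ((↑) : ℚ → ℝ) (𝓝 x),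
        dist (f p.1) (f p.2) ≤ r ^ n * c := by
    intro n
    induction n with
    | zero =>
      refine fun x _ => Eventually.of_forall fun p => ?_
      rw [pow_zero, one_mul]
      linarith [dist_le_norm_add_norm (f p.1) (f p.2), hC p.1, hC p.2]
    | succ n ih =>
      intro x hx
      rw [pow_succ', mul_assoc]
      exact eventually_dist_le_of_eventually_dist_le hk hper hrec hcont hC hr (by positivity) ih hx
  have : NeBot (comap ((↑) : ℚ → ℝ) (𝓝 x)) :=
    Rat.isDenseEmbedding_coe_real.isDenseInducing.comap_nhds_neBot x
  rw [← cauchy_map_iff_exists_tendsto, cauchy_map_iff',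
    Metric.uniformity_basis_dist.tendsto_right_iff]
  intro ε hε
  obtain ⟨n, hn⟩ := exists_pow_lt_of_lt_one (div_pos hε hc) hr1
  filter_upwards [hosc n x hx] with p hp
  exact hp.trans_lt ((lt_div_iff₀ hc).mp hn)

theorem tendsto_nhdsWithin_of_tendsto_comap_ratCast {f : ℚ → ℂ} {g : ℝ → ℂ}
    (hg : ∀ y : ℚ, g y = f y)
    (hgirr : ∀ x : ℝ, Irrational x → Tendsto f (comap ((↑) : ℚ → ℝ) (𝓝 x)) (𝓝 (g x)))
    {s : Set ℝ} (hs : IsOpen s) {x : ℝ} {l : ℂ}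
    (hf : Tendsto f (comap ((↑) : ℚ → ℝ) (𝓝[s] x)) (𝓝 l)) : Tendsto g (𝓝[s] x) (𝓝 l) := by
  refine Metric.nhds_basis_closedBall.tendsto_right_iff.mpr fun ε hε => ?_
  obtain ⟨t, ht, hts⟩ := hf (Metric.closedBall_mem_nhds l hε)
  obtain ⟨u, hu, hxu, hut⟩ := mem_nhdsWithin.mp ht
  refine mem_nhdsWithin.mpr ⟨u, hu, hxu, fun z hz => ?_⟩
  by_cases hzi : Irrational z
  · have : NeBot (comap ((↑) : ℚ → ℝ) (𝓝 z)) :=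
      Rat.isDenseEmbedding_coe_real.isDenseInducing.comap_nhds_neBot z
    refine Metric.isClosed_closedBall.mem_of_tendsto (hgirr z hzi) ?_
    exact (tendsto_comap.eventually ((hu.inter hs).mem_nhds hz)).mono fun y hy => hts (hut hy)
  · obtain ⟨y, rfl⟩ := not_not.mp hzi
    rw [mem_ofPred_eq, hg y]
    exact hts (hut hz)

theorem exists_extension_of_irrational {f : ℚ → ℂ}
    (hf : ∀ x : ℝ, Irrational x → ∃ l, Tendsto f (comap ((↑) : ℚ → ℝ) (𝓝 x)) (𝓝 l)) :
    ∃ g : ℝ → ℂ, (∀ y : ℚ, g y = f y) ∧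
      ∀ x : ℝ, Irrational x → Tendsto f (comap ((↑) : ℚ → ℝ) (𝓝 x)) (𝓝 (g x)) := by
  have key : ∀ x : ℝ, ∃ l, (∀ y : ℚ, (y : ℝ) = x → l = f y) ∧
      (Irrational x → Tendsto f (comap ((↑) : ℚ → ℝ) (𝓝 x)) (𝓝 l)) := by
    intro x
    by_cases hx : Irrational x
    · obtain ⟨l, hl⟩ := hf x hx
      exact ⟨l, fun y hy => absurd ⟨y, hy⟩ hx, fun _ => hl⟩
    · obtain ⟨y, hy⟩ := not_not.mp hx
      exact ⟨f y, fun z hz => by rw [Rat.cast_injective (hy.trans hz.symm)], fun h => absurd h hx⟩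
  choose g hg using key
  exact ⟨g, fun y => (hg y).1 y rfl, fun x => (hg x).2⟩

theorem eventually_mul_pos {x : ℝ} (hx : x ≠ 0) : ∀ᶠ t in 𝓝 x, 0 < x * t :=
  (continuous_const_mul x).tendsto x |>.eventually_const_lt (mul_self_pos.mpr hx)

theorem neg_one_div_lt_neg_one_div {a b : ℝ} (hab : 0 < a * b) (h : a < b) : -1 / a < -1 / b := by
  have ha : a ≠ 0 := left_ne_zero_of_mul hab.ne'
  have hb : b ≠ 0 := right_ne_zero_of_mul hab.ne'
  have : -1 / b - -1 / a = (b - a) / (a * b) := by field_simp; ring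
  linarith [div_pos (sub_pos.mpr h) hab]

/-- Extension and continuity properties of quantum modular forms of
weight `k` with `Re k < 0` whose period function is continuous on `[-1,1] \ {0}` with
finite one-sided limits at `0`. -/
theorem stmt0 (k : ℂ) (hk : k.re < 0) (f : ℚ → ℂ) (h : ℝ → ℂ)
    (hper : ∀ x : ℚ, f (x + 1) = f x)
    (hrec : ∀ x : ℚ, x ≠ 0 →
      f x - ((|((x : ℚ) : ℝ)| : ℝ) : ℂ) ^ (-k) * f (-1 / x) = h x)
    (hcont : ContinuousOn h (Set.Icc (-1 : ℝ) 1 \ {0}))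
    (h0p h0m : ℂ)
    (hlimp : Tendsto h (nhdsWithin 0 (Set.Ioi 0)) (nhds h0p))
    (hlimm : Tendsto h (nhdsWithin 0 (Set.Iio 0)) (nhds h0m)) :
    ∃ fd : ℝ → ℂ,
      -- `fd` agrees with `f` on the rationals
      (∀ y : ℚ, fd (y : ℝ) = f y) ∧
      -- (a) at every irrational `x`, `fd x` is the limit of `f(y)` as `ℚ ∋ y → x`
      (∀ x : ℝ, Irrational x →
        Tendsto (fun y : ℚ => f y) (Filter.comap ((↑) : ℚ → ℝ) (nhds x)) (nhds (fd x))) ∧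
      -- (b) `fd` is continuous at every irrational point
      (∀ x : ℝ, Irrational x → ContinuousAt fd x) ∧
      -- (c) one-sided limits at every rational `x = a/q`
      (∀ x : ℚ,
        Tendsto fd (nhdsWithin (x : ℝ) (Set.Ioi (x : ℝ)))
          (nhds (f x + ((x.den : ℝ) : ℂ) ^ k * (h0p - f 0))) ∧
        Tendsto fd (nhdsWithin (x : ℝ) (Set.Iio (x : ℝ)))
          (nhds (f x + ((x.den : ℝ) : ℂ) ^ k * (h0m - f 0)))) ∧
      -- in particular, `fd` is continuous on `ℝ` iff `h(0⁺) = h(0⁻) = f 0`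
      (Continuous fd ↔ (h0p = f 0 ∧ h0m = f 0)) := by
  obtain ⟨M, hM⟩ := exists_norm_le_of_tendsto_zero hcont hlimp hlimm
  obtain ⟨C, hC⟩ := exists_norm_le_of_period_function hk hper hrec hM
  obtain ⟨fd, hfd, hirr⟩ := exists_extension_of_irrational fun x hx =>
    exists_tendsto_comap_ratCast_of_irrational hk hper hrec hcont hC hx
  have hcirr : ∀ x : ℝ, Irrational x → ContinuousAt fd x := fun x hx => by
    have := tendsto_nhdsWithin_of_tendsto_comap_ratCast hfd hirr isOpen_univ (x := x)
      (by rw [nhdsWithin_univ]; exact hirr x hx)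
    rwa [nhdsWithin_univ] at this
  have hright : ∀ x : ℚ, Tendsto fd (𝓝[>] (x : ℝ))
      (𝓝 (f x + ((x.den : ℝ) : ℂ) ^ k * (h0p - f 0))) := fun x => by
    refine tendsto_nhdsWithin_of_tendsto_comap_ratCast hfd hirr isOpen_Ioi
      (tendsto_comap_ratCast_nhdsWithin hk hper hrec hcont hC (S := Ioi) (by simp) ?_ ?_ hlimp x)
    · intro x n
      exact tendsto_nhdsWithin_iff.mpr ⟨((continuous_add_const (n : ℝ)).tendsto x).mono_left
        nhdsWithin_le_nhds, eventually_mem_nhdsWithin.mono fun t ht => by simpa using ht⟩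
    · intro x hx
      refine tendsto_nhdsWithin_iff.mpr ⟨(tendsto_neg_one_div_nhds hx).mono_left
        nhdsWithin_le_nhds, ?_⟩
      filter_upwards [eventually_mem_nhdsWithin,
        nhdsWithin_le_nhds (eventually_mul_pos hx)] with t ht htx
      exact neg_one_div_lt_neg_one_div htx ht
  have hleft : ∀ x : ℚ, Tendsto fd (𝓝[<] (x : ℝ))
      (𝓝 (f x + ((x.den : ℝ) : ℂ) ^ k * (h0m - f 0))) := fun x => by
    refine tendsto_nhdsWithin_of_tendsto_comap_ratCast hfd hirr isOpen_Iio
      (tendsto_comap_ratCast_nhdsWithin hk hper hrec hcont hC (S := Iio) (by simp) ?_ ?_ hlimm x)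
    · intro x n
      exact tendsto_nhdsWithin_iff.mpr ⟨((continuous_add_const (n : ℝ)).tendsto x).mono_left
        nhdsWithin_le_nhds, eventually_mem_nhdsWithin.mono fun t ht => by simpa using ht⟩
    · intro x hx
      refine tendsto_nhdsWithin_iff.mpr ⟨(tendsto_neg_one_div_nhds hx).mono_left
        nhdsWithin_le_nhds, ?_⟩
      filter_upwards [eventually_mem_nhdsWithin,
        nhdsWithin_le_nhds (eventually_mul_pos hx)] with t ht htx
      exact neg_one_div_lt_neg_one_div (by rwa [mul_comm]) ht
  refine ⟨fd, hfd, hirr, hcirr, fun x => ⟨hright x, hleft x⟩, fun hc => ?_, ?_⟩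
  · have h0 : Tendsto fd (𝓝 ((0 : ℚ) : ℝ)) (𝓝 (f 0)) := by
      rw [← hfd 0]; exact hc.tendsto _
    have hp := tendsto_nhds_unique (hright 0) (h0.mono_left nhdsWithin_le_nhds)
    have hm := tendsto_nhds_unique (hleft 0) (h0.mono_left nhdsWithin_le_nhds)
    simp only [Rat.den_ofNat, Nat.cast_one, Complex.ofReal_one, Complex.one_cpow, one_mul,
      add_sub_cancel] at hp hm
    exact ⟨hp, hm⟩
  · rintro ⟨rfl, hm⟩
    refine continuous_iff_continuousAt.mpr fun x => ?_
    by_cases hx : Irrational x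
    · exact hcirr x hx
    · obtain ⟨y, rfl⟩ := not_not.mp hx
      refine continuousAt_iff_continuous_left'_right'.mpr ⟨?_, ?_⟩
      · simpa [ContinuousWithinAt, hfd, hm] using hleft y
      · simpa [ContinuousWithinAt, hfd] using hright y
end

section
/- Let k ∈ ℂ with Re(k) < 0 and δ > 0. Let f : ℚ → ℂ satisfy weak periodicity (f(x+1) = f(x) for all x ∈ ℚ\[−1,0]) and the reciprocity relation f(x) − |x|^{−k}·f(−1/x) = h(x) for all x ∈ ([−1,1] ∩ ℚ)\{0}, where h : ℝ\{0} → ℂ satisfies condition (coh) with parameter δ. Then there is a set X ⊆ ℝ\ℚ of full Lebesgue measure (its complement in ℝ is Lebesgue-null), invariant under x ↦ x+1, such that for every x ∈ X the limit f†(x) := lim_{j→∞} f(x_j) exists, where (x_j) is the sequence of continued-fraction convergents of x. Moreover, for every ε > 0 there is a subset X_ε ⊆ X, invariant under x ↦ x+1, with Lebesgue measure of X_ε ∩ [0,1] at least 1 − ε, such that f† restricted to X_ε is continuous in the subspace topology; in particular f† is Lebesgue-measurable on X. -/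
open Filter Topology MeasureTheory Set

/-- Partial quotients of the regular continued fraction expansion of `x`
(with the convention that `cfb j x = 0` for `j` beyond the length of the expansion). -/
noncomputable def cfb : ℕ → ℝ → ℤ
  | 0, x => ⌊x⌋
  | n + 1, x => cfb n (Int.fract x)⁻¹

/-- Numerators and denominators of the continued fraction convergents of `x`. -/
noncomputable def cfPQ (x : ℝ) : ℕ → ℤ × ℤ
  | 0 => (cfb 0 x, 1)
  | 1 => (cfb 1 x * cfb 0 x + 1, cfb 1 x)
  | n + 2 => (cfb (n + 2) x * (cfPQ x (n + 1)).1 + (cfPQ x n).1,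
              cfb (n + 2) x * (cfPQ x (n + 1)).2 + (cfPQ x n).2)

/-- The `n`-th continued fraction convergent of `x`, as a rational number. -/
noncomputable def cfConv (x : ℝ) (n : ℕ) : ℚ := ((cfPQ x n).1 : ℚ) / ((cfPQ x n).2 : ℚ)

/-- Condition (coh) on the period function `h`, with parameter `δ`:
(i) `sup {|h x - h y| : |x-y| < exp(-ε^(δ-1)), |x| > 2ε} → 0` as `ε → 0⁺`, and
(ii) `|h x| ≤ C · exp(|x|^(δ-1))` on `[-1,1] \ {0}`. -/
def cohCond (δ : ℝ) (h : ℝ → ℂ) : Prop :=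
  (∀ η : ℝ, 0 < η → ∃ ε₀ : ℝ, 0 < ε₀ ∧ ∀ ε : ℝ, 0 < ε → ε < ε₀ →
    ∀ x y : ℝ, x ∈ Set.Icc (-1 : ℝ) 1 → y ∈ Set.Icc (-1 : ℝ) 1 → x ≠ 0 → y ≠ 0 →
      |x - y| < Real.exp (-(ε ^ (δ - 1))) → 2 * ε < |x| → ‖h x - h y‖ ≤ η) ∧
  (∃ C : ℝ, 0 < C ∧ ∀ x : ℝ, x ∈ Set.Icc (-1 : ℝ) 1 → x ≠ 0 →
    ‖h x‖ ≤ C * Real.exp (|x| ^ (δ - 1)))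

/-- The Gauss map of the continued fraction algorithm. -/
noncomputable def gaussMap (t : ℝ) : ℝ := Int.fract t⁻¹

/-- The irrational numbers of the open unit interval. -/
def unitIrrational : Set ℝ := {t | Irrational t ∧ 0 < t ∧ t < 1}

/-- The continued fraction convergents `[0; b₁, …, bₙ₊₁]` of a number of the unit interval. -/
noncomputable def gaussConv : ℕ → ℝ → ℚ
  | 0, t => (⌊t⁻¹⌋ : ℚ)⁻¹
  | n + 1, t => (⌊t⁻¹⌋ + gaussConv n (gaussMap t))⁻¹

theorem fract_mem_unitIrrational {x : ℝ} (hx : Irrational x) :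
    Int.fract x ∈ unitIrrational := by
  have h1 : Irrational (Int.fract x) := hx.sub_intCast _
  exact ⟨h1, lt_of_le_of_ne (Int.fract_nonneg x) (fun e => h1.ne_zero e.symm), Int.fract_lt_one x⟩

theorem gaussMap_mem {t : ℝ} (ht : t ∈ unitIrrational) : gaussMap t ∈ unitIrrational :=
  fract_mem_unitIrrational ht.1.inv

theorem iterate_gaussMap_mem {t : ℝ} (ht : t ∈ unitIrrational) (n : ℕ) :
    gaussMap^[n] t ∈ unitIrrational := by
  induction n generalizing t with
  | zero => exact ht
  | succ n ih => exact ih (gaussMap_mem ht)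

theorem one_le_floor_inv {t : ℝ} (ht : t ∈ unitIrrational) : 1 ≤ ⌊t⁻¹⌋ :=
  Int.le_floor.2 (by simpa using (one_le_inv₀ ht.2.1).2 ht.2.2.le)

theorem eq_inv_floor_add_gaussMap (t : ℝ) : t = (⌊t⁻¹⌋ + gaussMap t)⁻¹ := by
  rw [gaussMap, Int.floor_add_fract, inv_inv]

theorem gaussConv_pos_le_one {t : ℝ} (ht : t ∈ unitIrrational) (n : ℕ) :
    0 < gaussConv n t ∧ gaussConv n t ≤ 1 := by
  induction n generalizing t with
  | zero =>
    have h1 : (1 : ℚ) ≤ ⌊t⁻¹⌋ := by exact_mod_cast one_le_floor_inv ht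
    exact ⟨inv_pos.2 (by linarith), inv_le_one_of_one_le₀ h1⟩
  | succ n ih =>
    have h1 : (1 : ℚ) ≤ ⌊t⁻¹⌋ := by exact_mod_cast one_le_floor_inv ht
    have h2 := ih (gaussMap_mem ht)
    exact ⟨inv_pos.2 (by linarith), inv_le_one_of_one_le₀ (by linarith)⟩

theorem half_le_gaussConv {t : ℝ} (ht : t ∈ unitIrrational) (n : ℕ) :
    t / 2 ≤ gaussConv n t := by
  have hb : (1 : ℝ) ≤ ⌊t⁻¹⌋ := by exact_mod_cast one_le_floor_inv ht
  have h1 : t ≤ (⌊t⁻¹⌋ : ℝ)⁻¹ := by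
    rw [le_inv_comm₀ ht.2.1 (by linarith)]; exact Int.floor_le _
  have h2 : (⌊t⁻¹⌋ : ℝ)⁻¹ / 2 ≤ (⌊t⁻¹⌋ + 1 : ℝ)⁻¹ := by
    rw [div_eq_mul_inv, ← mul_inv]
    exact inv_anti₀ (by linarith) (by linarith)
  have h3 : (⌊t⁻¹⌋ + 1 : ℝ)⁻¹ ≤ gaussConv n t := by
    cases n with
    | zero =>
      simp only [gaussConv]
      push_cast
      exact inv_anti₀ (by linarith) (by linarith)
    | succ n =>
      have h4 := gaussConv_pos_le_one (gaussMap_mem ht) n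
      have h5 : (0 : ℝ) < gaussConv n (gaussMap t) := by exact_mod_cast h4.1
      have h6 : (gaussConv n (gaussMap t) : ℝ) ≤ 1 := by exact_mod_cast h4.2
      simp only [gaussConv]
      push_cast
      exact inv_anti₀ (by linarith) (by linarith)
  linarith

theorem inv_add_mul_le_half {b c : ℝ} (hb : 1 ≤ b) (hc : 0 < c) (hc' : c ≤ 1) :
    (b + c)⁻¹ * c ≤ 1 / 2 := by
  rw [inv_mul_eq_div, div_le_div_iff₀ (by linarith) (by norm_num)]
  linarith

theorem gaussConv_succ_mul_le_half {t : ℝ} (ht : t ∈ unitIrrational) (n : ℕ) :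
    (gaussConv (n + 1) t : ℝ) * gaussConv n (gaussMap t) ≤ 1 / 2 := by
  have hb : (1 : ℝ) ≤ ⌊t⁻¹⌋ := by exact_mod_cast one_le_floor_inv ht
  have h4 := gaussConv_pos_le_one (gaussMap_mem ht) n
  have := inv_add_mul_le_half (c := gaussConv n (gaussMap t)) hb (by exact_mod_cast h4.1)
    (by exact_mod_cast h4.2)
  simpa only [gaussConv, Rat.cast_inv, Rat.cast_add, Rat.cast_intCast] using this

theorem mul_gaussMap_le_half {t : ℝ} (ht : t ∈ unitIrrational) : t * gaussMap t ≤ 1 / 2 := by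
  have hb : (1 : ℝ) ≤ ⌊t⁻¹⌋ := by exact_mod_cast one_le_floor_inv ht
  have h4 := gaussMap_mem ht
  have := inv_add_mul_le_half hb h4.2.1 h4.2.2.le
  rwa [← eq_inv_floor_add_gaussMap] at this

theorem prod_range_le_geometric {a : ℕ → ℝ} {n : ℕ} (h0 : ∀ i < n, 0 ≤ a i)
    (h1 : ∀ i < n, a i ≤ 1) (h2 : ∀ i, i + 1 < n → a i * a (i + 1) ≤ 1 / 2) {m : ℕ} (hm : m ≤ n) :
    ∏ i ∈ Finset.range m, a i ≤ 4 / 3 * (3 / 4) ^ m := by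
  induction m using Nat.twoStepInduction with
  | zero => norm_num
  | one => simpa using h1 0 hm
  | more m ih _ =>
    have h3 : 0 ≤ ∏ i ∈ Finset.range m, a i :=
      Finset.prod_nonneg fun i hi => h0 i (by have := Finset.mem_range.1 hi; omega)
    have h4 := h2 m (by omega)
    have h5 := ih (by omega)
    rw [Finset.prod_range_succ, Finset.prod_range_succ, mul_assoc]
    calc _ ≤ (∏ i ∈ Finset.range m, a i) * (1 / 2) := by gcongr
      _ ≤ (4 / 3 * (3 / 4) ^ m) * (1 / 2) := by gcongr
      _ ≤ 4 / 3 * (3 / 4) ^ (m + 2) := by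
        have : (0 : ℝ) < (3 / 4) ^ m := by positivity
        rw [pow_add]; linarith

theorem prod_iterate_gaussMap_le {t : ℝ} (ht : t ∈ unitIrrational) (m : ℕ) :
    ∏ i ∈ Finset.range m, gaussMap^[i] t ≤ 4 / 3 * (3 / 4) ^ m := by
  refine prod_range_le_geometric (n := m) (fun i _ => (iterate_gaussMap_mem ht i).2.1.le)
    (fun i _ => (iterate_gaussMap_mem ht i).2.2.le) (fun i _ => ?_) le_rfl
  rw [Function.iterate_succ_apply']
  exact mul_gaussMap_le_half (iterate_gaussMap_mem ht i)

theorem prod_gaussConv_le {t : ℝ} (ht : t ∈ unitIrrational) {n m : ℕ} (hm : m ≤ n + 1) :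
    ∏ i ∈ Finset.range m, (gaussConv (n - i) (gaussMap^[i] t) : ℝ) ≤ 4 / 3 * (3 / 4) ^ m := by
  refine prod_range_le_geometric (n := n + 1) (fun i _ => ?_) (fun i _ => ?_) (fun i hi => ?_) hm
  · exact_mod_cast (gaussConv_pos_le_one (iterate_gaussMap_mem ht i) _).1.le
  · exact_mod_cast (gaussConv_pos_le_one (iterate_gaussMap_mem ht i) _).2
  · rw [Function.iterate_succ_apply', show n - i = n - (i + 1) + 1 by omega]
    exact gaussConv_succ_mul_le_half (iterate_gaussMap_mem ht i) _

theorem abs_gaussConv_sub_le {t : ℝ} (ht : t ∈ unitIrrational) (n : ℕ) :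
    |(gaussConv n t : ℝ) - t| ≤ ∏ i ∈ Finset.range (n + 1), gaussMap^[i] t := by
  induction n generalizing t with
  | zero =>
    have hb : (1 : ℝ) ≤ ⌊t⁻¹⌋ := by exact_mod_cast one_le_floor_inv ht
    have h4 := gaussMap_mem ht
    simp only [zero_add, Finset.range_one, Finset.prod_singleton, Function.iterate_zero, id,
      gaussConv, Rat.cast_inv, Rat.cast_intCast]
    have h5 : (⌊t⁻¹⌋ : ℝ)⁻¹ - t = t * ((⌊t⁻¹⌋ : ℝ)⁻¹ * gaussMap t) := by
      have := eq_inv_floor_add_gaussMap t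
      have : t * (⌊t⁻¹⌋ + gaussMap t) = 1 := by
        nth_rw 1 [this]; exact inv_mul_cancel₀ (by linarith [h4.2.1])
      have h8 : (⌊t⁻¹⌋ : ℝ)⁻¹ * ⌊t⁻¹⌋ = 1 := inv_mul_cancel₀ (by linarith)
      linear_combination (-(⌊t⁻¹⌋ : ℝ)⁻¹) * this + t * h8
    rw [h5, abs_of_nonneg (by have := ht.2.1; have := h4.2.1; positivity)]
    have h6 : (⌊t⁻¹⌋ : ℝ)⁻¹ ≤ 1 := inv_le_one_of_one_le₀ hb
    have h7 : (⌊t⁻¹⌋ : ℝ)⁻¹ * gaussMap t ≤ 1 := mul_le_one₀ h6 h4.2.1.le h4.2.2.le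
    exact mul_le_of_le_one_right ht.2.1.le h7
  | succ n ih =>
    have hb : (1 : ℝ) ≤ ⌊t⁻¹⌋ := by exact_mod_cast one_le_floor_inv ht
    have h4 := gaussMap_mem ht
    have h5 := gaussConv_pos_le_one h4 n
    have h6 : (0 : ℝ) < gaussConv n (gaussMap t) := by exact_mod_cast h5.1
    have h7 := ih h4
    have h8 : (gaussConv (n + 1) t : ℝ) ≤ 1 := by exact_mod_cast (gaussConv_pos_le_one ht _).2
    have h9 : (0 : ℝ) < gaussConv (n + 1) t := by exact_mod_cast (gaussConv_pos_le_one ht _).1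
    have key : (gaussConv (n + 1) t : ℝ) - t =
        gaussConv (n + 1) t * t * (gaussMap t - gaussConv n (gaussMap t)) := by
      have e1 : t * (⌊t⁻¹⌋ + gaussMap t) = 1 := by
        nth_rw 1 [eq_inv_floor_add_gaussMap t]; exact inv_mul_cancel₀ (by linarith [h4.2.1])
      have e2 : (gaussConv (n + 1) t : ℝ) * (⌊t⁻¹⌋ + gaussConv n (gaussMap t)) = 1 := by
        simp only [gaussConv, Rat.cast_inv, Rat.cast_add, Rat.cast_intCast]
        exact inv_mul_cancel₀ (by linarith)
      linear_combination (-(gaussConv (n + 1) t : ℝ)) * e1 + t * e2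
    rw [Finset.prod_range_succ', key, abs_mul, abs_mul, abs_of_pos h9, abs_of_pos ht.2.1,
      abs_sub_comm, mul_comm (∏ _ ∈ _, _)]
    simp only [Function.iterate_zero, id, Function.iterate_succ_apply]
    have := ht.2.1
    gcongr
    exact mul_le_of_le_one_left ht.2.1.le h8

theorem tendsto_gaussConv {t : ℝ} (ht : t ∈ unitIrrational) :
    Tendsto (fun n => (gaussConv n t : ℝ)) atTop (𝓝 t) := by
  rw [tendsto_iff_dist_tendsto_zero]
  refine squeeze_zero (fun _ => dist_nonneg) (fun n => (abs_gaussConv_sub_le ht n).trans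
    (prod_iterate_gaussMap_le ht (n + 1))) ?_
  have := (tendsto_pow_atTop_nhds_zero_of_lt_one (r := (3 / 4 : ℝ)) (by norm_num)
    (by norm_num)).const_mul (4 / 3)
  simpa using (tendsto_add_atTop_iff_nat 1).2 this

theorem cfPQ_succ (x : ℝ) (n : ℕ) :
    cfPQ x (n + 1) = (⌊x⌋ * (cfPQ (Int.fract x)⁻¹ n).1 + (cfPQ (Int.fract x)⁻¹ n).2,
      (cfPQ (Int.fract x)⁻¹ n).1) := by
  induction n using Nat.twoStepInduction with
  | zero => simp [cfPQ, cfb, mul_comm]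
  | one =>
    simp only [cfPQ, cfb]
    ext
    · simp only; ring
    · rfl
  | more n ih1 ih2 =>
    rw [cfPQ, ih2, ih1]
    simp only [cfPQ, cfb]
    ext
    · simp only; ring
    · rfl

theorem cfPQ_pos {x : ℝ} (hx : Irrational x) (h1 : 1 < x) (n : ℕ) :
    0 < (cfPQ x n).1 ∧ 0 < (cfPQ x n).2 := by
  have hf : 1 ≤ ⌊x⌋ := Int.le_floor.2 (by simpa using h1.le)
  induction n generalizing x with
  | zero => simp only [cfPQ, cfb]; omega
  | succ n ih =>
    have h2 := fract_mem_unitIrrational hx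
    have h3 := ih h2.1.inv ((one_lt_inv₀ h2.2.1).2 h2.2.2) (one_le_floor_inv h2)
    rw [cfPQ_succ]
    have := h3.1
    have := h3.2
    exact ⟨by simp only; positivity, h3.1⟩

theorem cfConv_zero (x : ℝ) : cfConv x 0 = ⌊x⌋ := by simp [cfConv, cfPQ, cfb]

theorem cfConv_succ {x : ℝ} (hx : Irrational x) (n : ℕ) :
    cfConv x (n + 1) = ⌊x⌋ + (cfConv (Int.fract x)⁻¹ n)⁻¹ := by
  have h2 := fract_mem_unitIrrational hx
  have h3 := cfPQ_pos h2.1.inv ((one_lt_inv₀ h2.2.1).2 h2.2.2) n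
  have h4 : ((cfPQ (Int.fract x)⁻¹ n).1 : ℚ) ≠ 0 := by exact_mod_cast h3.1.ne'
  rw [cfConv, cfConv, cfPQ_succ, inv_div]
  push_cast
  rw [add_div, mul_div_cancel_right₀ _ h4]

theorem cfConv_succ_eq_gaussConv {x : ℝ} (hx : Irrational x) (n : ℕ) :
    cfConv x (n + 1) = ⌊x⌋ + gaussConv n (Int.fract x) := by
  rw [cfConv_succ hx]
  congr 1
  induction n generalizing x with
  | zero => rw [cfConv_zero, gaussConv]
  | succ n ih =>
    have h2 := fract_mem_unitIrrational hx
    rw [cfConv_succ h2.1.inv, gaussConv, ih h2.1.inv, gaussMap]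

theorem gaussConv_one_sub {t : ℝ} (ht : t ∈ unitIrrational) (h2 : t < 1 / 2) (n : ℕ) :
    gaussConv (n + 1) (1 - t) = 1 - gaussConv n t := by
  have ht0 := ht.2.1
  have e1 : (1 - t)⁻¹ = 1 + t / (1 - t) := by
    have : 1 - t ≠ 0 := by linarith
    field_simp; ring
  have e2 : 0 ≤ t / (1 - t) := div_nonneg ht0.le (by linarith)
  have e3 : t / (1 - t) < 1 := by rw [div_lt_one (by linarith)]; linarith
  have f1 : ⌊(1 - t)⁻¹⌋ = 1 := by
    rw [Int.floor_eq_iff, e1]; push_cast; constructor <;> linarith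
  have g1 : gaussMap (1 - t) = t / (1 - t) := by
    rw [gaussMap, Int.fract, f1, e1]; push_cast; ring
  have e4 : (t / (1 - t))⁻¹ = t⁻¹ - 1 := by
    have : 1 - t ≠ 0 := by linarith
    field_simp
  have f2 : ⌊(t / (1 - t))⁻¹⌋ = ⌊t⁻¹⌋ - 1 := by rw [e4, Int.floor_sub_one]
  have g2 : gaussMap (t / (1 - t)) = gaussMap t := by
    rw [gaussMap, e4, Int.fract_sub_one, gaussMap]
  have hb : (2 : ℚ) ≤ ⌊t⁻¹⌋ := by
    have : (2 : ℤ) ≤ ⌊t⁻¹⌋ := Int.le_floor.2 (by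
      push_cast; rw [le_inv_comm₀ (by norm_num) ht0]; linarith)
    exact_mod_cast this
  have key : ∀ y : ℚ, 0 ≤ y →
      (((1 : ℤ) : ℚ) + (((⌊t⁻¹⌋ - 1 : ℤ) : ℚ) + y)⁻¹)⁻¹ = 1 - (⌊t⁻¹⌋ + y)⁻¹ := by
    intro y hy
    push_cast
    generalize (⌊t⁻¹⌋ : ℚ) = b at hb
    have h3 : b - 1 + y ≠ 0 := by linarith
    have h4 : b + y ≠ 0 := by linarith
    rw [show (1 : ℚ) + (b - 1 + y)⁻¹ = (b + y) / (b - 1 + y) by field_simp; ring]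
    field_simp
    ring
  rw [gaussConv, f1, g1]
  cases n with
  | zero => rw [gaussConv, gaussConv, f2]; simpa using key 0 le_rfl
  | succ n =>
    rw [gaussConv, gaussConv, f2, g2]
    exact key _ (gaussConv_pos_le_one (gaussMap_mem ht) n).1.le

theorem cohCond.continuousOn {δ : ℝ} {h : ℝ → ℂ} (hc : cohCond δ h) :
    ContinuousOn h (Icc (-1) 1 \ {0}) := by
  intro x hx
  have hx0 : x ≠ 0 := hx.2
  rw [ContinuousWithinAt, Metric.tendsto_nhdsWithin_nhds]
  intro η hη
  obtain ⟨ε₀, hε₀, H⟩ := hc.1 (η / 2) (by linarith)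
  have hxa : 0 < |x| := abs_pos.2 hx0
  have hm : 0 < min ε₀ (|x| / 2) := lt_min hε₀ (by linarith)
  have h1 := min_le_left ε₀ (|x| / 2)
  have h2 := min_le_right ε₀ (|x| / 2)
  refine ⟨_, Real.exp_pos (-((min ε₀ (|x| / 2) / 2) ^ (δ - 1))), fun y hy hxy => ?_⟩
  have := H (min ε₀ (|x| / 2) / 2) (by linarith) (by linarith) x y hx.1 hy.1 hx0 hy.2
    (by rwa [abs_sub_comm]) (by linarith)
  rw [dist_comm, dist_eq_norm]
  linarith

theorem cohCond.bound_mono {δ δ' : ℝ} {h : ℝ → ℂ} (hc : cohCond δ h) (hδ : δ' ≤ δ) :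
    ∃ C : ℝ, 0 < C ∧ ∀ x ∈ Icc (-1 : ℝ) 1, x ≠ 0 → ‖h x‖ ≤ C * Real.exp (|x| ^ (δ' - 1)) := by
  obtain ⟨C, hC, H⟩ := hc.2
  refine ⟨C, hC, fun x hx hx0 => (H x hx hx0).trans ?_⟩
  have h1 : |x| ^ (δ - 1) ≤ |x| ^ (δ' - 1) :=
    Real.rpow_le_rpow_of_exponent_ge (abs_pos.2 hx0) (abs_le.2 hx) (by linarith)
  gcongr

/-- The terms of the series obtained by iterating the reciprocity relation along the orbit `w`. -/
noncomputable def orbitTerm (k : ℂ) (h : ℝ → ℂ) (s : ℚ) (w : ℕ → ℝ) (i : ℕ) : ℂ :=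
  (∏ l ∈ Finset.range i, (w l : ℂ) ^ (-k)) * h (s * (-1) ^ i * w i)

theorem orbitTerm_zero (k : ℂ) (h : ℝ → ℂ) (s : ℚ) (w : ℕ → ℝ) :
    orbitTerm k h s w 0 = h (s * w 0) := by
  simp [orbitTerm]

theorem orbitTerm_succ (k : ℂ) (h : ℝ → ℂ) (s : ℚ) (w : ℕ → ℝ) (i : ℕ) :
    orbitTerm k h s w (i + 1) = (w 0 : ℂ) ^ (-k) * orbitTerm k h (-s) (fun l => w (l + 1)) i := by
  rw [orbitTerm, orbitTerm, Finset.prod_range_succ',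
    show (s * (-1) ^ (i + 1) * w (i + 1) : ℝ) = ((-s : ℚ) : ℝ) * (-1) ^ i * w (i + 1) by
      push_cast; ring]
  ring

theorem norm_prod_cpow_le {k : ℂ} (hk : k.re < 0) {w : ℕ → ℝ} {m : ℕ}
    (h0 : ∀ l < m, 0 < w l) (hp : ∏ l ∈ Finset.range m, w l ≤ 4 / 3 * (3 / 4) ^ m) :
    ‖∏ l ∈ Finset.range m, (w l : ℂ) ^ (-k)‖ ≤ (4 / 3 * (3 / 4) ^ m) ^ (-k.re) := by
  have h1 : ∀ l ∈ Finset.range m, 0 < w l := fun l hl => h0 l (Finset.mem_range.1 hl)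
  have h2 : ‖∏ l ∈ Finset.range m, (w l : ℂ) ^ (-k)‖ =
      (∏ l ∈ Finset.range m, w l) ^ (-k.re) := by
    rw [norm_prod, ← Real.finsetProd_rpow _ _ (fun l hl => (h1 l hl).le)]
    refine Finset.prod_congr rfl fun l hl => ?_
    rw [Complex.norm_cpow_eq_rpow_re_of_pos (h1 l hl), Complex.neg_re]
  rw [h2]
  exact Real.rpow_le_rpow (Finset.prod_nonneg fun l hl => (h1 l hl).le) hp (by linarith)

theorem sign_mul_mem {s : ℚ} (hs : s = 1 ∨ s = -1) (i : ℕ) {w : ℝ} (h0 : 0 < w) (h1 : w ≤ 1) :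
    (s * (-1) ^ i * w : ℝ) ∈ Icc (-1 : ℝ) 1 \ {0} ∧ |(s * (-1) ^ i * w : ℝ)| = w := by
  have h2 : |(s * (-1) ^ i * w : ℝ)| = w := by
    rw [abs_mul, abs_mul, abs_pow, abs_neg, abs_one, one_pow, mul_one, abs_of_pos h0]
    rcases hs with rfl | rfl <;> simp
  refine ⟨⟨abs_le.1 (h2.trans_le h1), fun e => ?_⟩, h2⟩
  rw [mem_singleton_iff.1 e, abs_zero] at h2
  linarith

theorem norm_orbitTerm_le {k : ℂ} (hk : k.re < 0) {δ : ℝ} (hδ : δ < 1) {h : ℝ → ℂ} {C : ℝ}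
    (hC : 0 < C)
    (hb : ∀ x ∈ Icc (-1 : ℝ) 1, x ≠ 0 → ‖h x‖ ≤ C * Real.exp (|x| ^ (δ - 1)))
    {s : ℚ} (hs : s = 1 ∨ s = -1) {w : ℕ → ℝ} {i : ℕ} (h0 : ∀ l ≤ i, 0 < w l)
    (hp : ∏ l ∈ Finset.range i, w l ≤ 4 / 3 * (3 / 4) ^ i) (h1 : w i ≤ 1)
    {a : ℝ} (ha : 0 < a) (haw : a ≤ w i) :
    ‖orbitTerm k h s w i‖ ≤ (4 / 3 * (3 / 4) ^ i) ^ (-k.re) * (C * Real.exp (a ^ (δ - 1))) := by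
  rw [orbitTerm, norm_mul]
  have h2 := sign_mul_mem hs i (h0 i le_rfl) h1
  have h3 := hb _ h2.1.1 h2.1.2
  rw [h2.2] at h3
  have h4 : w i ^ (δ - 1) ≤ a ^ (δ - 1) := Real.rpow_le_rpow_of_nonpos ha haw (by linarith)
  refine mul_le_mul (norm_prod_cpow_le hk (fun l hl => h0 l hl.le) hp) (h3.trans ?_)
    (norm_nonneg _) (by positivity)
  gcongr

theorem summable_exp_rpow_sub_mul {p c : ℝ} (hp : p < 1) (hc : 0 < c) (M : ℝ) :
    Summable fun i : ℕ => Real.exp (M * ((i : ℝ) + 1) ^ p - c * ((i : ℝ) + 1)) := by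
  have h1 : Tendsto (fun x : ℝ => M * x ^ (-(1 - p))) atTop (𝓝 0) := by
    simpa using (tendsto_rpow_neg_atTop (by linarith : 0 < 1 - p)).const_mul M
  have h2 : ∀ᶠ x : ℝ in atTop, M * x ^ p ≤ c / 2 * x := by
    filter_upwards [h1.eventually_lt_const (half_pos hc), eventually_gt_atTop 0] with x hx hx0
    have : x ^ p = x ^ (-(1 - p)) * x := by
      rw [← Real.rpow_add_one hx0.ne']; ring_nf
    rw [this, ← mul_assoc]
    gcongr
  have h3 : Tendsto (fun i : ℕ => (i : ℝ) + 1) atTop atTop :=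
    tendsto_atTop_add_const_right _ _ tendsto_natCast_atTop_atTop
  have h4 : Summable fun i : ℕ => Real.exp (i * (-(c / 2))) :=
    Real.summable_exp_nat_mul_iff.2 (by linarith)
  refine summable_of_isBigO_nat h4 (Asymptotics.IsBigO.of_bound 1 ?_)
  filter_upwards [h3.eventually h2] with i hi
  rw [Real.norm_eq_abs, Real.norm_eq_abs, Real.abs_exp, Real.abs_exp, one_mul, Real.exp_le_exp]
  linarith

/-- The lower bounds imposed on the orbits under the Gauss map. -/
noncomputable def orbitBound (δ : ℝ) (N i : ℕ) : ℝ :=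
  ((N : ℝ) + 1)⁻¹ * (((i : ℝ) + 1) ^ (1 + δ))⁻¹

theorem orbitBound_pos (δ : ℝ) (N i : ℕ) : 0 < orbitBound δ N i := by
  unfold orbitBound; positivity

theorem summable_orbitTerm_bound {κ δ C : ℝ} (hκ : 0 < κ) (hδ : 0 < δ) (N : ℕ) :
    Summable fun i : ℕ =>
      (4 / 3 * (3 / 4) ^ i) ^ κ * (C * Real.exp ((orbitBound δ N i / 2) ^ (δ - 1))) := by
  have hc : 0 < -Real.log (3 / 4) * κ :=
    mul_pos (neg_pos.2 (Real.log_neg (by norm_num) (by norm_num))) hκ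
  have h1 := (summable_exp_rpow_sub_mul (p := 1 - δ ^ 2) (by nlinarith) hc
    ((((N : ℝ) + 1)⁻¹ / 2) ^ (δ - 1))).mul_left
      ((4 / 3 : ℝ) ^ κ * C * Real.exp (-Real.log (3 / 4) * κ))
  refine h1.congr fun i => ?_
  have hi : (0 : ℝ) < (i : ℝ) + 1 := by positivity
  have e1 : (orbitBound δ N i / 2) ^ (δ - 1) =
      (((N : ℝ) + 1)⁻¹ / 2) ^ (δ - 1) * ((i : ℝ) + 1) ^ (1 - δ ^ 2) := by
    rw [orbitBound, mul_div_right_comm, Real.mul_rpow (by positivity) (by positivity),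
      ← Real.rpow_neg hi.le, ← Real.rpow_mul hi.le]
    ring_nf
  have e2 : (4 / 3 * (3 / 4) ^ i : ℝ) ^ κ =
      (4 / 3) ^ κ * Real.exp (Real.log (3 / 4) * κ * i) := by
    rw [Real.mul_rpow (by positivity) (by positivity), ← Real.rpow_natCast,
      ← Real.rpow_mul (by positivity), Real.rpow_def_of_pos (by norm_num : (0 : ℝ) < 3 / 4)]
    ring_nf
  rw [e1, e2, sub_eq_add_neg, Real.exp_add]
  have e3 : Real.exp (-(-Real.log (3 / 4) * κ * ((i : ℝ) + 1))) =
      Real.exp (Real.log (3 / 4) * κ * i) * Real.exp (Real.log (3 / 4) * κ) := by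
    rw [← Real.exp_add]; ring_nf
  have e4 : Real.exp (-Real.log (3 / 4) * κ) * Real.exp (Real.log (3 / 4) * κ) = 1 := by
    rw [← Real.exp_add]; simp
  rw [e3]
  linear_combination ((4 / 3 : ℝ) ^ κ * C * Real.exp (Real.log (3 / 4) * κ * i) *
    Real.exp ((((N : ℝ) + 1)⁻¹ / 2) ^ (δ - 1) * ((i : ℝ) + 1) ^ (1 - δ ^ 2))) * e4

section Reciprocity

variable {f : ℚ → ℂ} (hper : ∀ x : ℚ, x ∉ Set.Icc (-1 : ℚ) 0 → f (x + 1) = f x)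
include hper

theorem apply_sign_mul_add {s : ℚ} (hs : s = 1 ∨ s = -1) {r : ℚ} (hr : 0 < r) (m : ℕ) :
    f (s * (m + r)) = f (s * r) := by
  induction m with
  | zero => simp
  | succ m ih =>
    rw [← ih]
    have hm : (0 : ℚ) ≤ m := by positivity
    rcases hs with rfl | rfl
    · rw [← hper (1 * (m + r)) (fun h => by linarith [h.2])]
      push_cast; ring_nf
    · rw [← hper (-1 * ((m + 1 : ℕ) + r)) (fun h => by push_cast at h; linarith [h.1])]
      push_cast; ring_nf

theorem apply_sign_mul_int_add {s : ℚ} (hs : s = 1 ∨ s = -1) {r : ℚ} (hr : 0 < r) {m : ℤ}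
    (hm : 0 ≤ m) : f (s * (m + r)) = f (s * r) := by
  lift m to ℕ using hm
  exact_mod_cast apply_sign_mul_add hper hs hr m

variable {k : ℂ} {h : ℝ → ℂ} (hrec : ∀ x : ℚ, x ∈ Set.Icc (-1 : ℚ) 1 → x ≠ 0 →
      f x - ((|((x : ℚ) : ℝ)| : ℝ) : ℂ) ^ (-k) * f (-1 / x) = h x)
include hrec

theorem apply_sign_mul_inv {s : ℚ} (hs : s = 1 ∨ s = -1) {b : ℤ} (hb : 1 ≤ b) {y : ℚ}
    (hy : 0 ≤ y) {z : ℚ} (hz : 0 < z) (hzy : ∃ m : ℤ, 0 ≤ m ∧ b + y = m + z) :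
    f (s * (b + y)⁻¹) =
      (((b + y : ℚ)⁻¹ : ℚ) : ℂ) ^ (-k) * f (-s * z) + h ((s * (b + y : ℚ)⁻¹ : ℚ) : ℝ) := by
  obtain ⟨m, hm, e⟩ := hzy
  have hb' : (1 : ℚ) ≤ b := by exact_mod_cast hb
  have h0 : 0 < ((b : ℚ) + y)⁻¹ := inv_pos.2 (by linarith)
  have h1 : ((b : ℚ) + y)⁻¹ ≤ 1 := inv_le_one_of_one_le₀ (by linarith)
  have h2 : |s * ((b : ℚ) + y)⁻¹| = ((b : ℚ) + y)⁻¹ := by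
    rw [abs_mul, abs_of_pos h0]
    rcases hs with rfl | rfl <;> simp
  have h3 : s * ((b : ℚ) + y)⁻¹ ≠ 0 := by
    rw [← abs_pos, h2]; exact h0
  have h4 := hrec _ (abs_le.1 (h2.trans_le h1)) h3
  have h5 : -1 / (s * ((b : ℚ) + y)⁻¹) = -s * (m + z) := by
    rw [← e]
    rcases hs with rfl | rfl <;> simp
  rw [← Rat.cast_abs, h2, h5, apply_sign_mul_int_add hper _ hz hm] at h4
  · rw [← h4]; push_cast; ring
  · rcases hs with rfl | rfl <;> simp

theorem apply_gaussConv {t : ℝ} (ht : t ∈ unitIrrational) (n : ℕ) {s : ℚ} (hs : s = 1 ∨ s = -1) :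
    f (s * gaussConv n t) = (∑ i ∈ Finset.range (n + 1),
        orbitTerm k h s (fun l => gaussConv (n - l) (gaussMap^[l] t)) i) +
      (∏ l ∈ Finset.range (n + 1), ((gaussConv (n - l) (gaussMap^[l] t) : ℝ) : ℂ) ^ (-k)) *
        f (s * (-1) ^ (n + 1)) := by
  induction n generalizing t s with
  | zero =>
    have := apply_sign_mul_inv hper hrec hs (one_le_floor_inv ht) le_rfl one_pos
      ⟨⌊t⁻¹⌋ - 1, by linarith [one_le_floor_inv ht], by push_cast; ring⟩
    simp only [add_zero] at this
    rw [← gaussConv] at this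
    rw [this]
    simp [orbitTerm_zero]
    ring
  | succ n ih =>
    have h1 := gaussMap_mem ht
    have h2 := (gaussConv_pos_le_one h1 n).1
    have h3 := apply_sign_mul_inv hper hrec hs (one_le_floor_inv ht) h2.le h2
      ⟨⌊t⁻¹⌋, by linarith [one_le_floor_inv ht], rfl⟩
    rw [← gaussConv, ih h1 (s := -s) (by rcases hs with rfl | rfl <;> simp)] at h3
    rw [h3, Finset.sum_range_succ' _ (n + 1), Finset.prod_range_succ' _ (n + 1), orbitTerm_zero]
    simp only [orbitTerm_succ, Function.iterate_succ_apply, Nat.add_sub_add_right,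
      Function.iterate_zero, id, Nat.sub_zero, ← Finset.mul_sum]
    rw [show -s * (-1) ^ (n + 1) = s * (-1) ^ (n + 1 + 1) by ring]
    push_cast
    ring

end Reciprocity
/-- The numbers whose orbit under the Gauss map approaches zero only slowly. -/
def slowOrbits (δ : ℝ) (N : ℕ) : Set ℝ :=
  {t | t ∈ unitIrrational ∧ ∀ i, orbitBound δ N i ≤ gaussMap^[i] t}

/-- The sum of the series obtained by iterating the reciprocity relation. -/
noncomputable def orbitSeries (k : ℂ) (h : ℝ → ℂ) (s : ℚ) (t : ℝ) : ℂ :=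
  ∑' i, orbitTerm k h s (fun l => gaussMap^[l] t) i

theorem continuousOn_iterate_gaussMap (n : ℕ) : ContinuousOn gaussMap^[n] unitIrrational := by
  induction n with
  | zero => exact continuousOn_id
  | succ n ih =>
    rw [Function.iterate_succ]
    refine ih.comp (fun t ht => ContinuousAt.continuousWithinAt ?_) (fun t ht => gaussMap_mem ht)
    exact ContinuousAt.comp (g := Int.fract) (continuousAt_fract (ht.1.inv.ne_int _))
      (continuousAt_inv₀ ht.2.1.ne')

section Convergence

variable {k : ℂ} (hk : k.re < 0) {δ : ℝ} (hδ : 0 < δ) (hδ1 : δ < 1) {h : ℝ → ℂ}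
  (hcont : ContinuousOn h (Icc (-1) 1 \ {0})) {C : ℝ} (hC : 0 < C)
  (hb : ∀ x ∈ Icc (-1 : ℝ) 1, x ≠ 0 → ‖h x‖ ≤ C * Real.exp (|x| ^ (δ - 1)))
  {s : ℚ} (hs : s = 1 ∨ s = -1)

include hk hδ hδ1 hcont hC hb hs

theorem continuousOn_orbitSeries (N : ℕ) :
    ContinuousOn (orbitSeries k h s) (slowOrbits δ N) := by
  refine continuousOn_tsum (fun i => ?_)
    (summable_orbitTerm_bound (κ := -k.re) (C := C) (by linarith) hδ N) (fun i t ht => ?_)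
  · have hsub : slowOrbits δ N ⊆ unitIrrational := fun t ht => ht.1
    have hcast : ∀ l, ContinuousOn (fun t => ((gaussMap^[l] t : ℝ) : ℂ)) (slowOrbits δ N) :=
      fun l => Complex.continuous_ofReal.comp_continuousOn
        ((continuousOn_iterate_gaussMap l).mono hsub)
    refine ContinuousOn.mul (continuousOn_finsetProd _ fun l _ => (hcast l).cpow_const
      fun t ht => Complex.ofReal_mem_slitPlane.2 (iterate_gaussMap_mem ht.1 l).2.1) ?_
    refine hcont.comp (continuousOn_const.mul ((continuousOn_iterate_gaussMap i).mono hsub))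
      fun t ht => ?_
    have := iterate_gaussMap_mem ht.1 i
    exact (sign_mul_mem hs i this.2.1 this.2.2.le).1
  · exact norm_orbitTerm_le hk hδ1 hC hb hs (fun l _ => (iterate_gaussMap_mem ht.1 l).2.1)
      (prod_iterate_gaussMap_le ht.1 i) (iterate_gaussMap_mem ht.1 i).2.2.le
      (half_pos (orbitBound_pos δ N i))
      ((half_le_self (orbitBound_pos δ N i).le).trans (ht.2 i))

theorem tendsto_apply_gaussConv {f : ℚ → ℂ}
    (hper : ∀ x : ℚ, x ∉ Set.Icc (-1 : ℚ) 0 → f (x + 1) = f x)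
    (hrec : ∀ x : ℚ, x ∈ Set.Icc (-1 : ℚ) 1 → x ≠ 0 →
      f x - ((|((x : ℚ) : ℝ)| : ℝ) : ℂ) ^ (-k) * f (-1 / x) = h x)
    {N : ℕ} {t : ℝ} (ht : t ∈ slowOrbits δ N) :
    Tendsto (fun n => f (s * gaussConv n t)) atTop (𝓝 (orbitSeries k h s t)) := by
  have hpos : ∀ n l, (0 : ℝ) < gaussConv n (gaussMap^[l] t) := fun n l => by
    exact_mod_cast (gaussConv_pos_le_one (iterate_gaussMap_mem ht.1 l) n).1
  have hle : ∀ n l, (gaussConv n (gaussMap^[l] t) : ℝ) ≤ 1 := fun n l => by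
    exact_mod_cast (gaussConv_pos_le_one (iterate_gaussMap_mem ht.1 l) n).2
  have hlim : ∀ l, Tendsto (fun n => (gaussConv (n - l) (gaussMap^[l] t) : ℝ)) atTop
      (𝓝 (gaussMap^[l] t)) := fun l =>
    (tendsto_gaussConv (iterate_gaussMap_mem ht.1 l)).comp (tendsto_sub_atTop_nat l)
  have hterm : ∀ i, Tendsto
      (fun n => orbitTerm k h s (fun l => gaussConv (n - l) (gaussMap^[l] t)) i) atTop
      (𝓝 (orbitTerm k h s (fun l => gaussMap^[l] t) i)) := by
    intro i
    refine Tendsto.mul (tendsto_finsetProd _ fun l _ => ?_) ?_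
    · exact ((Complex.continuous_ofReal.tendsto _).comp (hlim l)).cpow tendsto_const_nhds
        (Complex.ofReal_mem_slitPlane.2 (iterate_gaussMap_mem ht.1 l).2.1)
    · have hi := iterate_gaussMap_mem ht.1 i
      refine (hcont _ (sign_mul_mem hs i hi.2.1 hi.2.2.le).1).tendsto.comp
        (tendsto_nhdsWithin_iff.2 ⟨(hlim i).const_mul _, Eventually.of_forall fun n => ?_⟩)
      exact (sign_mul_mem hs i (hpos _ i) (hle _ i)).1
  have hsum : Tendsto (fun n => ∑' i, if i ∈ Finset.range (n + 1) then
      orbitTerm k h s (fun l => gaussConv (n - l) (gaussMap^[l] t)) i else 0) atTop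
      (𝓝 (orbitSeries k h s t)) := by
    refine tendsto_tsum_of_dominated_convergence
      (summable_orbitTerm_bound (κ := -k.re) (C := C) (by linarith) hδ N) (fun i => ?_)
      (Eventually.of_forall fun n i => ?_)
    · refine (hterm i).congr' ?_
      filter_upwards [eventually_ge_atTop i] with n hn
      rw [if_pos (Finset.mem_range.2 (by omega))]
    · split_ifs with hi
      · have hi' := Finset.mem_range.1 hi
        refine norm_orbitTerm_le hk hδ1 hC hb hs (fun l _ => hpos _ l)
          (prod_gaussConv_le ht.1 hi'.le) (hle _ i) (half_pos (orbitBound_pos δ N i)) ?_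
        have := half_le_gaussConv (iterate_gaussMap_mem ht.1 i) (n - i)
        linarith [ht.2 i]
      · rw [norm_zero]; positivity
  have hrem : Tendsto (fun n => (∏ l ∈ Finset.range (n + 1),
      ((gaussConv (n - l) (gaussMap^[l] t) : ℝ) : ℂ) ^ (-k)) * f (s * (-1) ^ (n + 1))) atTop
      (𝓝 0) := by
    have h1 : Tendsto (fun n : ℕ => (4 / 3 * (3 / 4 : ℝ) ^ (n + 1)) ^ (-k.re) *
        (‖f 1‖ + ‖f (-1)‖)) atTop (𝓝 0) := by
      have h2 : Tendsto (fun n : ℕ => 4 / 3 * (3 / 4 : ℝ) ^ (n + 1)) atTop (𝓝 0) := by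
        simpa using ((tendsto_add_atTop_iff_nat 1).2 (tendsto_pow_atTop_nhds_zero_of_lt_one
          (r := (3 / 4 : ℝ)) (by norm_num) (by norm_num))).const_mul (4 / 3)
      have h3 := h2.rpow_const (p := -k.re) (Or.inr (by linarith))
      rw [Real.zero_rpow (by linarith)] at h3
      simpa using h3.mul_const (‖f 1‖ + ‖f (-1)‖)
    refine squeeze_zero_norm (fun n => ?_) h1
    rw [norm_mul]
    refine mul_le_mul (norm_prod_cpow_le hk (fun l _ => hpos _ l)
      (prod_gaussConv_le ht.1 le_rfl)) ?_ (norm_nonneg _) (by positivity)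
    have h4 : s * (-1) ^ (n + 1) = 1 ∨ s * (-1) ^ (n + 1) = -1 := by
      rcases hs with rfl | rfl <;> rcases neg_one_pow_eq_or ℚ (n + 1) with e | e <;> simp [e]
    rcases h4 with e | e <;> rw [e] <;> linarith [norm_nonneg (f 1), norm_nonneg (f (-1))]
  have := hsum.add hrem
  rw [add_zero] at this
  refine this.congr fun n => ?_
  rw [apply_gaussConv hper hrec ht.1 n hs]
  congr 1
  rw [tsum_eq_sum (s := Finset.range (n + 1)) (fun i hi => if_neg hi)]
  exact Finset.sum_congr rfl fun i hi => if_pos hi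

end Convergence
theorem measurable_gaussMap : Measurable gaussMap :=
  measurable_fract.comp measurable_inv

/-- The (unnormalized) Gauss measure. -/
noncomputable def gaussMeasure : Measure ℝ :=
  (volume.restrict (Ioo 0 1)).withDensity fun x => ENNReal.ofReal (1 + x)⁻¹

theorem gaussMeasure_apply {A : Set ℝ} (hA : MeasurableSet A) :
    gaussMeasure A = ∫⁻ x in A ∩ Ioo 0 1, ENNReal.ofReal (1 + x)⁻¹ := by
  rw [gaussMeasure, withDensity_apply _ hA, Measure.restrict_restrict hA]

theorem gaussMeasure_le_volume {A : Set ℝ} (hA : MeasurableSet A) :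
    gaussMeasure A ≤ volume (A ∩ Ioo 0 1) := by
  rw [gaussMeasure_apply hA, ← setLIntegral_one]
  refine setLIntegral_mono measurable_const fun x hx => ?_
  rw [← ENNReal.ofReal_one]
  exact ENNReal.ofReal_le_ofReal (inv_le_one_of_one_le₀ (by linarith [hx.2.1]))

theorem volume_le_two_mul_gaussMeasure {A : Set ℝ} (hA : MeasurableSet A) :
    volume (A ∩ Ioo 0 1) ≤ 2 * gaussMeasure A := by
  have hm : Measurable fun x : ℝ => ENNReal.ofReal (1 + x)⁻¹ := by fun_prop
  rw [gaussMeasure_apply hA, ← setLIntegral_one, ← lintegral_const_mul _ hm]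
  refine setLIntegral_mono (hm.const_mul _) fun x hx => ?_
  rw [← ENNReal.ofReal_ofNat, ← ENNReal.ofReal_mul (by norm_num), ← ENNReal.ofReal_one]
  refine ENNReal.ofReal_le_ofReal ?_
  rw [← div_eq_mul_inv, le_div_iff₀ (by linarith [hx.2.1])]
  linarith [hx.2.2]

theorem sum_inv_mul_inv_le {y : ℝ} (hy : 0 ≤ y) (n : ℕ) :
    ∑ i ∈ Finset.range n, ((i + 1 + y) ^ 2)⁻¹ * (1 + (i + 1 + y)⁻¹)⁻¹ ≤ (1 + y)⁻¹ := by
  have h1 : ∑ i ∈ Finset.range n, ((i + 1 + y) ^ 2)⁻¹ * (1 + (i + 1 + y)⁻¹)⁻¹ =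
      (1 + y)⁻¹ - (n + 1 + y)⁻¹ := by
    have := Finset.sum_range_sub' (fun i : ℕ => ((i : ℝ) + 1 + y)⁻¹) n
    simp only [Nat.cast_zero, zero_add] at this
    rw [← this]
    refine Finset.sum_congr rfl fun i _ => ?_
    have h2 : (i : ℝ) + 1 + y ≠ 0 := by positivity
    have h3 : (i : ℝ) + 1 + 1 + y ≠ 0 := by positivity
    have h4 : 1 + ((i : ℝ) + 1 + y)⁻¹ = (i + 1 + 1 + y) / (i + 1 + y) := by field_simp; ring
    rw [h4]
    push_cast
    field_simp
    ring
  rw [h1]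
  have : (0 : ℝ) ≤ (n + 1 + y)⁻¹ := by positivity
  linarith

theorem gaussMeasure_preimage_le {A : Set ℝ} (hA : MeasurableSet A) :
    gaussMeasure (gaussMap ⁻¹' A) ≤ gaussMeasure A := by
  rw [gaussMeasure_apply hA, gaussMeasure_apply (measurable_gaussMap hA)]
  set φ : ℕ → ℝ → ℝ := fun n y => (n + 1 + y)⁻¹
  have hB : MeasurableSet (A ∩ Ico 0 1) := hA.inter measurableSet_Ico
  have hcov : gaussMap ⁻¹' A ∩ Ioo 0 1 ⊆ ⋃ n : ℕ, φ n '' (A ∩ Ico 0 1) := by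
    rintro x ⟨hxA, hx0, hx1⟩
    have hb : 1 ≤ ⌊x⁻¹⌋ := Int.le_floor.2 (by simpa using (one_le_inv₀ hx0).2 hx1.le)
    obtain ⟨n, hn⟩ := Int.eq_ofNat_of_zero_le (sub_nonneg.2 hb)
    refine mem_iUnion.2 ⟨n, gaussMap x, ⟨hxA, Int.fract_nonneg _, Int.fract_lt_one _⟩, ?_⟩
    have h1 : (n : ℝ) + 1 = ⌊x⁻¹⌋ := by
      have : (n : ℤ) + 1 = ⌊x⁻¹⌋ := by omega
      exact_mod_cast this
    simp only [φ, h1]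
    exact (eq_inv_floor_add_gaussMap x).symm
  have hchange : ∀ n : ℕ, ∫⁻ x in φ n '' (A ∩ Ico 0 1), ENNReal.ofReal (1 + x)⁻¹ =
      ∫⁻ y in A ∩ Ico 0 1,
        ENNReal.ofReal (((n + 1 + y) ^ 2)⁻¹ * (1 + (n + 1 + y)⁻¹)⁻¹) := by
    intro n
    rw [lintegral_image_eq_lintegral_abs_deriv_mul (f' := fun y => -1 / (n + 1 + y) ^ 2) hB]
    · refine setLIntegral_congr_fun hB fun y hy => ?_
      have h1 : |(-1 : ℝ) / (n + 1 + y) ^ 2| = ((n + 1 + y) ^ 2)⁻¹ := by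
        rw [abs_div, abs_neg, abs_one, one_div, abs_of_nonneg (by positivity)]
      simp only [h1, φ]
      rw [ENNReal.ofReal_mul (by positivity)]
    · intro y hy
      have hy0 : (0 : ℝ) ≤ y := hy.2.1
      exact (((hasDerivAt_id y).const_add (n + 1 : ℝ)).inv (by positivity)).hasDerivWithinAt
    · intro y _ z _ hyz
      exact add_left_cancel (inv_injective hyz)
  calc ∫⁻ x in gaussMap ⁻¹' A ∩ Ioo 0 1, ENNReal.ofReal (1 + x)⁻¹
      ≤ ∫⁻ x in ⋃ n : ℕ, φ n '' (A ∩ Ico 0 1), ENNReal.ofReal (1 + x)⁻¹ := lintegral_mono_set hcov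
    _ ≤ ∑' n : ℕ, ∫⁻ x in φ n '' (A ∩ Ico 0 1), ENNReal.ofReal (1 + x)⁻¹ :=
      lintegral_iUnion_le _ _
    _ = ∫⁻ y in A ∩ Ico 0 1, ∑' n : ℕ,
        ENNReal.ofReal (((n + 1 + y) ^ 2)⁻¹ * (1 + (n + 1 + y)⁻¹)⁻¹) := by
      rw [lintegral_tsum fun n => by fun_prop]
      exact tsum_congr hchange
    _ ≤ ∫⁻ y in A ∩ Ico 0 1, ENNReal.ofReal (1 + y)⁻¹ := by
      refine setLIntegral_mono (by fun_prop) fun y hy => ENNReal.tsum_le_of_sum_range_le fun n => ?_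
      have hy0 : (0 : ℝ) ≤ y := hy.2.1
      rw [← ENNReal.ofReal_sum_of_nonneg fun i _ => by positivity]
      exact ENNReal.ofReal_le_ofReal (sum_inv_mul_inv_le hy0 n)
    _ = ∫⁻ y in A ∩ Ioo 0 1, ENNReal.ofReal (1 + y)⁻¹ :=
      setLIntegral_congr ((ae_eq_refl A).inter Ioo_ae_eq_Ico.symm)

theorem gaussMeasure_preimage_iterate_le {A : Set ℝ} (hA : MeasurableSet A) (n : ℕ) :
    gaussMeasure (gaussMap^[n] ⁻¹' A) ≤ gaussMeasure A := by
  induction n with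
  | zero => exact le_rfl
  | succ n ih =>
    rw [Function.iterate_succ, preimage_comp]
    exact (gaussMeasure_preimage_le (measurable_gaussMap.iterate n hA)).trans ih

theorem volume_iterate_gaussMap_lt_le {u : ℝ} (n : ℕ) :
    volume (gaussMap^[n] ⁻¹' Iio u ∩ Ioo 0 1) ≤ 2 * ENNReal.ofReal u := by
  refine (volume_le_two_mul_gaussMeasure (measurable_gaussMap.iterate n measurableSet_Iio)).trans ?_
  gcongr
  refine (gaussMeasure_preimage_iterate_le measurableSet_Iio n).trans
    ((gaussMeasure_le_volume measurableSet_Iio).trans ?_)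
  calc volume (Iio u ∩ Ioo 0 1) ≤ volume (Ioo 0 u) := measure_mono fun x hx => ⟨hx.2.1, hx.1⟩
    _ = ENNReal.ofReal u := by rw [Real.volume_Ioo, sub_zero]

theorem measurableSet_setOf_irrational : MeasurableSet {x : ℝ | Irrational x} :=
  (countable_range ((↑) : ℚ → ℝ)).measurableSet.compl

theorem measurableSet_slowOrbits (δ : ℝ) (N : ℕ) : MeasurableSet (slowOrbits δ N) := by
  have h1 : slowOrbits δ N = ({x | Irrational x} ∩ Ioo 0 1) ∩
      ⋂ i, gaussMap^[i] ⁻¹' Ici (orbitBound δ N i) := by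
    ext t
    simp [slowOrbits, unitIrrational, and_assoc]
  rw [h1]
  exact (measurableSet_setOf_irrational.inter measurableSet_Ioo).inter
    (MeasurableSet.iInter fun i => measurable_gaussMap.iterate i measurableSet_Ici)

theorem volume_unitInterval_diff_slowOrbits_le {δ : ℝ} (hδ : 0 < δ) :
    ∃ S : ℝ, 0 ≤ S ∧
      ∀ N : ℕ, volume (Icc 0 1 \ slowOrbits δ N) ≤ ENNReal.ofReal (S / ((N : ℝ) + 1)) := by
  have hsum : Summable fun i : ℕ => (((i : ℝ) + 1) ^ (1 + δ))⁻¹ := by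
    have := (summable_nat_add_iff 1).2
      (Real.summable_nat_rpow_inv.2 (by linarith : 1 < 1 + δ))
    simpa using this
  refine ⟨2 * ∑' i : ℕ, (((i : ℝ) + 1) ^ (1 + δ))⁻¹,
    mul_nonneg (by norm_num) (tsum_nonneg fun i => by positivity), fun N => ?_⟩
  have hcov : Icc 0 1 \ slowOrbits δ N ⊆ range ((↑) : ℚ → ℝ) ∪
      ⋃ i, gaussMap^[i] ⁻¹' Iio (orbitBound δ N i) ∩ Ioo 0 1 := by
    rintro t ⟨ht, hts⟩
    by_cases hirr : Irrational t
    · have h0 : 0 < t := lt_of_le_of_ne ht.1 hirr.ne_zero.symm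
      have h1 : t < 1 := lt_of_le_of_ne ht.2 hirr.ne_one
      right
      by_contra hcon
      refine hts ⟨⟨hirr, h0, h1⟩, fun i => ?_⟩
      by_contra! hlt
      exact hcon (mem_iUnion.2 ⟨i, hlt, h0, h1⟩)
    · left
      simpa [Irrational] using hirr
  calc volume (Icc 0 1 \ slowOrbits δ N)
      ≤ volume (range ((↑) : ℚ → ℝ)) +
        volume (⋃ i, gaussMap^[i] ⁻¹' Iio (orbitBound δ N i) ∩ Ioo 0 1) :=
        (measure_mono hcov).trans (measure_union_le _ _)
    _ ≤ 0 + ∑' i, 2 * ENNReal.ofReal (orbitBound δ N i) := by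
      gcongr
      · exact ((countable_range _).measure_zero _).le
      · exact (measure_iUnion_le _).trans
          (ENNReal.tsum_le_tsum fun i => volume_iterate_gaussMap_lt_le i)
    _ = ENNReal.ofReal (2 * (∑' i : ℕ, (((i : ℝ) + 1) ^ (1 + δ))⁻¹) / ((N : ℝ) + 1)) := by
      rw [zero_add, ENNReal.tsum_mul_left, ← ENNReal.ofReal_tsum_of_nonneg
        (fun i => (orbitBound_pos δ N i).le) (hsum.mul_left _), ← ENNReal.ofReal_ofNat,
        ← ENNReal.ofReal_mul (by norm_num)]
      simp only [orbitBound]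
      rw [tsum_mul_left]
      congr 1
      ring

/-- The real numbers `x` for which the Gauss orbits of both `x` and `-x` modulo one approach zero
only slowly. -/
def slowReals (δ : ℝ) (N : ℕ) : Set ℝ :=
  {x | Int.fract x ∈ slowOrbits δ N ∧ 1 - Int.fract x ∈ slowOrbits δ N}

theorem irrational_of_mem_slowReals {δ : ℝ} {N : ℕ} {x : ℝ} (hx : x ∈ slowReals δ N) :
    Irrational x := by
  have := hx.1.1.1.add_intCast ⌊x⌋
  rwa [Int.fract_add_floor] at this

theorem measurableSet_slowReals (δ : ℝ) (N : ℕ) : MeasurableSet (slowReals δ N) :=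
  (measurable_fract (measurableSet_slowOrbits δ N)).inter
    ((measurable_const.sub measurable_fract) (measurableSet_slowOrbits δ N))

theorem mem_slowReals_iff_add_one {δ : ℝ} {N : ℕ} (x : ℝ) :
    x ∈ slowReals δ N ↔ x + 1 ∈ slowReals δ N := by
  simp only [slowReals, mem_ofPred_eq, Int.fract_add_one]

theorem volume_unitInterval_diff_slowReals_le {δ : ℝ} (hδ : 0 < δ) :
    ∃ S : ℝ, 0 ≤ S ∧
      ∀ N : ℕ, volume (Icc 0 1 \ slowReals δ N) ≤ ENNReal.ofReal (S / ((N : ℝ) + 1)) := by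
  obtain ⟨S, hS, H⟩ := volume_unitInterval_diff_slowOrbits_le hδ
  refine ⟨S + S, by linarith, fun N => ?_⟩
  have hm : MeasurableSet (Icc 0 1 \ slowOrbits δ N) :=
    measurableSet_Icc.diff (measurableSet_slowOrbits δ N)
  have hcov : Icc 0 1 \ slowReals δ N ⊆ {1} ∪ ((Icc 0 1 \ slowOrbits δ N) ∪
      (fun x => 1 - x) ⁻¹' (Icc 0 1 \ slowOrbits δ N)) := by
    rintro x ⟨hx, hxs⟩
    rcases hx.2.eq_or_lt with h1 | h1
    · exact Or.inl h1
    right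
    have hf : Int.fract x = x := Int.fract_eq_self.2 ⟨hx.1, h1⟩
    rw [slowReals, mem_ofPred_eq, hf, not_and_or] at hxs
    rcases hxs with h2 | h2
    · exact Or.inl ⟨hx, h2⟩
    · exact Or.inr ⟨⟨by linarith [hx.2], by linarith [hx.1]⟩, h2⟩
  calc volume (Icc 0 1 \ slowReals δ N)
      ≤ volume {(1 : ℝ)} + (volume (Icc 0 1 \ slowOrbits δ N) +
        volume ((fun x => 1 - x) ⁻¹' (Icc 0 1 \ slowOrbits δ N))) :=
        (measure_mono hcov).trans ((measure_union_le _ _).trans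
          (by gcongr; exact measure_union_le _ _))
    _ ≤ 0 + (ENNReal.ofReal (S / ((N : ℝ) + 1)) + ENNReal.ofReal (S / ((N : ℝ) + 1))) := by
      rw [(Measure.measurePreserving_sub_left volume (1 : ℝ)).measure_preimage
        hm.nullMeasurableSet, Real.volume_singleton]
      gcongr <;> exact H N
    _ = ENNReal.ofReal ((S + S) / ((N : ℝ) + 1)) := by
      rw [zero_add, ← ENNReal.ofReal_add (by positivity) (by positivity), ← add_div]

theorem tendsto_const_div_nat_add_one (S : ℝ) :
    Tendsto (fun N : ℕ => ENNReal.ofReal (S / ((N : ℝ) + 1))) atTop (𝓝 0) := by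
  have h1 : Tendsto (fun N : ℕ => S / ((N : ℝ) + 1)) atTop (𝓝 0) := by
    simpa [div_eq_mul_inv] using (tendsto_one_div_add_atTop_nhds_zero_nat (𝕜 := ℝ)).const_mul S
  simpa using ENNReal.tendsto_ofReal h1

theorem volume_compl_iUnion_slowReals {δ : ℝ} (hδ : 0 < δ) :
    volume (⋃ N, slowReals δ N)ᶜ = 0 := by
  obtain ⟨S, -, H⟩ := volume_unitInterval_diff_slowReals_le hδ
  set B : Set ℝ := Icc 0 1 \ ⋃ N, slowReals δ N
  have hB : volume B = 0 := le_antisymm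
    (ge_of_tendsto' (tendsto_const_div_nat_add_one S) fun N =>
      (measure_mono (sdiff_subset_sdiff_right (subset_iUnion _ N))).trans (H N)) zero_le
  have hcov : (⋃ N, slowReals δ N)ᶜ ⊆ ⋃ m : ℤ, (fun x => x + (m : ℝ)) ⁻¹' B := by
    intro x hx
    refine mem_iUnion.2 ⟨-⌊x⌋, ?_⟩
    have h1 : x + ((-⌊x⌋ : ℤ) : ℝ) = Int.fract x := by rw [Int.fract]; push_cast; ring
    rw [mem_preimage, h1]
    refine ⟨⟨Int.fract_nonneg x, (Int.fract_lt_one x).le⟩, fun h2 => hx ?_⟩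
    simpa [slowReals] using h2
  refine measure_mono_null hcov (measure_iUnion_null fun m => ?_)
  rw [measure_preimage_add_right, hB]

theorem measurable_cfb (n : ℕ) : Measurable (cfb n) := by
  induction n with
  | zero => exact Int.measurable_floor
  | succ n ih => exact ih.comp measurable_fract.inv

theorem measurable_cfPQ (n : ℕ) : Measurable fun x => cfPQ x n := by
  have hb := measurable_cfb
  induction n using Nat.twoStepInduction with
  | zero => exact (hb 0).prodMk measurable_const
  | one => exact (((hb 1).mul (hb 0)).add_const 1).prodMk (hb 1)
  | more n ih1 ih2 =>
    exact (((hb (n + 2)).mul ih2.fst).add ih1.fst).prodMk (((hb (n + 2)).mul ih2.snd).add ih1.snd)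

theorem measurable_apply_cfConv (f : ℚ → ℂ) (n : ℕ) : Measurable fun x => f (cfConv x n) :=
  (measurable_of_countable fun p : ℤ × ℤ => f ((p.1 : ℚ) / (p.2 : ℚ))).comp (measurable_cfPQ n)

/-- The limit of the values along the continued fraction convergents. -/
noncomputable def convergentLimit (k : ℂ) (h : ℝ → ℂ) (x : ℝ) : ℂ :=
  if 0 < x then orbitSeries k h 1 (Int.fract x) else orbitSeries k h (-1) (1 - Int.fract x)

theorem one_sub_mem_unitIrrational {t : ℝ} (ht : t ∈ unitIrrational) : 1 - t ∈ unitIrrational :=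
  ⟨by simpa using ht.1.intCast_sub 1, by linarith [ht.2.2], by linarith [ht.2.1]⟩

theorem tendsto_comp_one_sub_gaussConv {g : ℚ → ℂ} {t : ℝ} (ht : t ∈ unitIrrational) {z : ℂ}
    (hg : Tendsto (fun n => g (gaussConv n (1 - t))) atTop (𝓝 z)) :
    Tendsto (fun n => g (1 - gaussConv n t)) atTop (𝓝 z) := by
  have h2 : t ≠ 1 / 2 := by simpa using ht.1.ne_rat (1 / 2)
  rcases h2.lt_or_gt with h3 | h3
  · simp only [← gaussConv_one_sub ht h3]
    exact (tendsto_add_atTop_iff_nat 1).2 hg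
  · refine (tendsto_add_atTop_iff_nat 1).1 (hg.congr fun n => ?_)
    have := gaussConv_one_sub (one_sub_mem_unitIrrational ht) (by linarith) n
    rw [sub_sub_cancel] at this
    rw [this, sub_sub_cancel]

theorem eventually_gaussConv_lt_one {t : ℝ} (ht : t ∈ unitIrrational) :
    ∀ᶠ n in atTop, gaussConv n t < 1 := by
  filter_upwards [(tendsto_gaussConv ht).eventually_lt_const ht.2.2] with n hn
  exact_mod_cast hn

section ConvergentLimit

variable {k : ℂ} (hk : k.re < 0) {δ : ℝ} (hδ : 0 < δ) (hδ1 : δ < 1) {h : ℝ → ℂ}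
  (hcont : ContinuousOn h (Icc (-1) 1 \ {0})) {C : ℝ} (hC : 0 < C)
  (hb : ∀ x ∈ Icc (-1 : ℝ) 1, x ≠ 0 → ‖h x‖ ≤ C * Real.exp (|x| ^ (δ - 1)))

include hk hδ hδ1 hcont hC hb

theorem continuousOn_convergentLimit (N : ℕ) :
    ContinuousOn (convergentLimit k h) (slowReals δ N) := by
  intro x hx
  have hirr := irrational_of_mem_slowReals hx
  have hfract : ContinuousWithinAt Int.fract (slowReals δ N) x :=
    (continuousAt_fract (hirr.ne_int _)).continuousWithinAt
  have hG : ∀ s : ℚ, s = 1 ∨ s = -1 → ContinuousOn (orbitSeries k h s) (slowOrbits δ N) :=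
    fun s hs => continuousOn_orbitSeries hk hδ hδ1 hcont hC hb hs N
  rcases hirr.ne_zero.symm.lt_or_gt with h0 | h0
  · refine ContinuousWithinAt.congr_of_eventuallyEq
      (f := fun y => orbitSeries k h 1 (Int.fract y)) ?_ ?_ (if_pos h0)
    · exact ContinuousWithinAt.comp (hG 1 (Or.inl rfl) _ hx.1) hfract fun y hy => hy.1
    · filter_upwards [mem_nhdsWithin_of_mem_nhds (lt_mem_nhds h0)] with y hy
      exact if_pos hy
  · refine ContinuousWithinAt.congr_of_eventuallyEq
      (f := fun y => orbitSeries k h (-1) (1 - Int.fract y)) ?_ ?_ (if_neg h0.not_gt)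
    · exact ContinuousWithinAt.comp (f := fun y => 1 - Int.fract y) (hG (-1) (Or.inr rfl) _ hx.2)
        (continuousWithinAt_const.sub hfract) fun y hy => hy.2
    · filter_upwards [mem_nhdsWithin_of_mem_nhds (gt_mem_nhds h0)] with y hy
      exact if_neg hy.not_gt

theorem tendsto_apply_cfConv {f : ℚ → ℂ}
    (hper : ∀ x : ℚ, x ∉ Set.Icc (-1 : ℚ) 0 → f (x + 1) = f x)
    (hrec : ∀ x : ℚ, x ∈ Set.Icc (-1 : ℚ) 1 → x ≠ 0 →
      f x - ((|((x : ℚ) : ℝ)| : ℝ) : ℂ) ^ (-k) * f (-1 / x) = h x)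
    {N : ℕ} {x : ℝ} (hx : x ∈ slowReals δ N) :
    Tendsto (fun n => f (cfConv x n)) atTop (𝓝 (convergentLimit k h x)) := by
  have hirr := irrational_of_mem_slowReals hx
  rw [← tendsto_add_atTop_iff_nat 1]
  simp only [cfConv_succ_eq_gaussConv hirr]
  rcases hirr.ne_zero.symm.lt_or_gt with h0 | h0
  · rw [convergentLimit, if_pos h0]
    refine (tendsto_apply_gaussConv hk hδ hδ1 hcont hC hb (Or.inl rfl) hper hrec hx.1).congr
      fun n => ?_
    rw [← apply_sign_mul_int_add hper (Or.inl rfl) (gaussConv_pos_le_one hx.1.1 n).1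
      (Int.floor_nonneg.2 h0.le), one_mul]
  · rw [convergentLimit, if_neg h0.not_gt]
    have h1 := tendsto_comp_one_sub_gaussConv (g := fun r => f (-1 * r)) hx.1.1
      (tendsto_apply_gaussConv hk hδ hδ1 hcont hC hb (Or.inr rfl) hper hrec hx.2)
    refine h1.congr' ?_
    filter_upwards [eventually_gaussConv_lt_one hx.1.1] with n hn
    have h2 : ⌊x⌋ < 0 := Int.floor_lt.2 (by simpa using h0)
    rw [← apply_sign_mul_int_add hper (Or.inr rfl) (sub_pos.2 hn)
      (show 0 ≤ -(⌊x⌋ + 1) by omega)]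
    push_cast
    ring_nf

end ConvergentLimit

/-- Almost-everywhere extension `f†` along continued fraction convergents,
for `Re k < 0` and a period function satisfying (coh). -/
theorem stmt2 (k : ℂ) (hk : k.re < 0) (δ : ℝ) (hδ : 0 < δ)
    (f : ℚ → ℂ) (h : ℝ → ℂ)
    (hper : ∀ x : ℚ, x ∉ Set.Icc (-1 : ℚ) 0 → f (x + 1) = f x)
    (hrec : ∀ x : ℚ, x ∈ Set.Icc (-1 : ℚ) 1 → x ≠ 0 →
      f x - ((|((x : ℚ) : ℝ)| : ℝ) : ℂ) ^ (-k) * f (-1 / x) = h x)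
    (hcoh : cohCond δ h) :
    ∃ (X : Set ℝ) (F : ℝ → ℂ),
      (∀ x ∈ X, Irrational x) ∧
      MeasurableSet X ∧ volume Xᶜ = 0 ∧
      (∀ x : ℝ, x ∈ X ↔ x + 1 ∈ X) ∧
      (∀ x ∈ X, Tendsto (fun j : ℕ => f (cfConv x j)) atTop (nhds (F x))) ∧
      Measurable F ∧
      (∀ ε : ℝ, 0 < ε → ∃ Xε : Set ℝ, Xε ⊆ X ∧
        (∀ x : ℝ, x ∈ Xε ↔ x + 1 ∈ Xε) ∧
        ENNReal.ofReal (1 - ε) ≤ volume (Xε ∩ Set.Icc (0 : ℝ) 1) ∧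
        ContinuousOn F Xε) := by
  have hδ' : 0 < min δ (1 / 2) := lt_min hδ (by norm_num)
  have hδ1 : min δ (1 / 2) < 1 := (min_le_right _ _).trans_lt (by norm_num)
  obtain ⟨C, hC, hb⟩ := hcoh.bound_mono (min_le_left δ (1 / 2))
  generalize min δ (1 / 2) = d at hδ' hδ1 hb
  have hcont := hcoh.continuousOn
  have hmeas : MeasurableSet (⋃ N, slowReals d N) :=
    MeasurableSet.iUnion fun N => measurableSet_slowReals d N
  have hlim : ∀ x ∈ ⋃ N, slowReals d N,
      Tendsto (fun n => f (cfConv x n)) atTop (𝓝 (convergentLimit k h x)) := fun x hx => by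
    obtain ⟨N, hN⟩ := mem_iUnion.1 hx
    exact tendsto_apply_cfConv hk hδ' hδ1 hcont hC hb hper hrec hN
  refine ⟨⋃ N, slowReals d N, (⋃ N, slowReals d N).indicator (convergentLimit k h),
    fun x hx => ?_, hmeas, volume_compl_iUnion_slowReals hδ', fun x => ?_, fun x hx => ?_, ?_,
    fun ε hε => ?_⟩
  · obtain ⟨N, hN⟩ := mem_iUnion.1 hx
    exact irrational_of_mem_slowReals hN
  · simp only [mem_iUnion, ← mem_slowReals_iff_add_one]
  · rw [indicator_of_mem hx]
    exact hlim x hx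
  · refine measurable_of_tendsto_metrizable
      (f := fun n => (⋃ N, slowReals d N).indicator fun x => f (cfConv x n))
      (fun n => (measurable_apply_cfConv f n).indicator hmeas) (tendsto_pi_nhds.2 fun x => ?_)
    by_cases hx : x ∈ ⋃ N, slowReals d N
    · simpa only [indicator_of_mem hx] using hlim x hx
    · simpa only [indicator_of_notMem hx] using tendsto_const_nhds
  · obtain ⟨S, -, H⟩ := volume_unitInterval_diff_slowReals_le hδ'
    obtain ⟨N, hN⟩ := ((tendsto_const_div_nat_add_one S).eventually_lt_const
      (ENNReal.ofReal_pos.2 hε)).exists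
    refine ⟨slowReals d N, subset_iUnion _ N, mem_slowReals_iff_add_one, ?_,
      (continuousOn_convergentLimit hk hδ' hδ1 hcont hC hb N).congr fun x hx =>
        indicator_of_mem (mem_iUnion.2 ⟨N, hx⟩) _⟩
    rw [ENNReal.ofReal_sub _ hε.le, tsub_le_iff_right]
    calc ENNReal.ofReal 1 = volume (Icc (0 : ℝ) 1) := by rw [Real.volume_Icc, sub_zero]
      _ ≤ volume (Icc 0 1 ∩ slowReals d N) + volume (Icc 0 1 \ slowReals d N) :=
        measure_le_inter_add_sdiff _ _ _
      _ ≤ volume (slowReals d N ∩ Icc 0 1) + ENNReal.ofReal ε := by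
        rw [inter_comm]
        gcongr
        exact (H N).trans hN.le
end
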